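/- arXiv:2601.12565 — 6 statements merged into one kernel-verified Lean document; each statement's English description precedes it below -/
import Mathlib

section
/- Let A = (A₀, A₁, τ) be a filtered ring such that (A₀, τ(A₁)) is a Henselian pair (A₀ is Henselian along the ideal τ(A₁)). Then: (1) a filtered A-module M is finite projective if and only if M is isomorphic to (L₀ ⊗_{A₀} A(0)) ⊕ (L₁ ⊗_{A₀} A(1)) for some finite projective A₀-modules L₀ and L₁; (2) the assignment (L₀, L₁) ↦ (L₀ ⊗_{A₀} A(0)) ⊕ (L₁ ⊗_{A₀} A(1)) induces a bijection from the set of pairs of isomorphism classes of finite projective A₀-modules to the set of isomorphism classes of finite projective filtered A-modules. -/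
open TensorProduct

universe u

/-- A filtered ring: a commutative ring `A₀` together with a quasi-ideal
`τ : A₁ → A₀` (so `τ x • y = τ y • x` for `x y : A₁`). -/
structure FilteredRing (A0 : Type u) [CommRing A0] : Type (u + 1) where
  A1 : Type u
  [acg : AddCommGroup A1]
  [mod : Module A0 A1]
  τ : A1 →ₗ[A0] A0
  symm : ∀ x y : A1, τ x • y = τ y • x

attribute [instance] FilteredRing.acg FilteredRing.mod

variable {A0 : Type u} [CommRing A0]

/-- A filtered module over a filtered ring. -/
structure FilteredModule (A : FilteredRing A0) : Type (u + 1) where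
  M0 : Type u
  M1 : Type u
  [acg0 : AddCommGroup M0]
  [acg1 : AddCommGroup M1]
  [mod0 : Module A0 M0]
  [mod1 : Module A0 M1]
  τM : M1 →ₗ[A0] M0
  act : A.A1 → M0 → M1
  act_add_left : ∀ a b m, act (a + b) m = act a m + act b m
  act_add_right : ∀ a m m', act a (m + m') = act a m + act a m'
  act_smul_left : ∀ (r : A0) a m, act (r • a) m = r • act a m
  act_smul_right : ∀ (r : A0) a m, act a (r • m) = r • act a m
  τM_act : ∀ a m, τM (act a m) = A.τ a • m
  act_τM : ∀ a n, act a (τM n) = A.τ a • n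

attribute [instance] FilteredModule.acg0 FilteredModule.acg1
attribute [instance] FilteredModule.mod0 FilteredModule.mod1

/-- An isomorphism of filtered modules. -/
structure FilteredModuleEquiv {A : FilteredRing A0} (M N : FilteredModule A) :
    Type u where
  e0 : M.M0 ≃ₗ[A0] N.M0
  e1 : M.M1 ≃ₗ[A0] N.M1
  comm_τ : ∀ m, e0 (M.τM m) = N.τM (e1 m)
  comm_act : ∀ a m, e1 (M.act a m) = N.act a (e0 m)

/-- Direct sum of filtered modules. -/
def FilteredModule.dsum {A : FilteredRing A0} (M N : FilteredModule A) :
    FilteredModule A where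
  M0 := M.M0 × N.M0
  M1 := M.M1 × N.M1
  τM := M.τM.prodMap N.τM
  act a m := (M.act a m.1, N.act a m.2)
  act_add_left a b m := by
    simp only [M.act_add_left, N.act_add_left]; rfl
  act_add_right a m m' := by
    simp only [Prod.fst_add, Prod.snd_add, M.act_add_right, N.act_add_right]; rfl
  act_smul_left r a m := by
    simp only [M.act_smul_left, N.act_smul_left]; rfl
  act_smul_right r a m := by
    simp only [Prod.smul_fst, Prod.smul_snd, M.act_smul_right, N.act_smul_right]; rfl
  τM_act a m := by
    simp only [LinearMap.prodMap_apply, M.τM_act, N.τM_act]; rfl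
  act_τM a n := by
    simp only [LinearMap.prodMap_apply, M.act_τM, N.act_τM]; rfl

/-- The finite free filtered module: the direct sum of `m` copies of `A(0)` and `n`
copies of `A(1)`. -/
def FilteredRing.finFree (A : FilteredRing A0) (m n : ℕ) : FilteredModule A where
  M0 := (Fin m → A0) × (Fin n → A0)
  M1 := (Fin m → A.A1) × (Fin n → A0)
  τM := (A.τ.compLeft (Fin m)).prodMap LinearMap.id
  act a fg := (fun i => fg.1 i • a, fun i => A.τ a * fg.2 i)
  act_add_left a b fg := by
    ext i <;> simp [smul_add, map_add, add_mul]
  act_add_right a fg fg' := by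
    ext i <;> simp [add_smul, mul_add]
  act_smul_left r a fg := by
    ext i <;> simp [smul_comm r, map_smul, smul_eq_mul, mul_assoc]
  act_smul_right r a fg := by
    ext i <;> simp [smul_eq_mul, mul_smul, mul_left_comm]
  τM_act a fg := by
    ext i <;> simp [map_smul, smul_eq_mul, mul_comm]
  act_τM a fg := by
    ext i
    · exact A.symm (fg.1 i) a
    · simp [smul_eq_mul]

/-- The contraction `L₀ ⊗ A₁ → L₀`, `l ⊗ a ↦ τ(a) • l`. -/
noncomputable def contractTensor (A : FilteredRing A0) (L0 : Type u)
    [AddCommGroup L0] [Module A0 L0] : L0 ⊗[A0] A.A1 →ₗ[A0] L0 :=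
  TensorProduct.lift (((LinearMap.lsmul A0 L0).comp A.τ).flip)

theorem contractTensor_tmul (A : FilteredRing A0) (L0 : Type u)
    [AddCommGroup L0] [Module A0 L0] (l : L0) (a : A.A1) :
    contractTensor A L0 (l ⊗ₜ[A0] a) = A.τ a • l := by
  simp [contractTensor]

theorem contractTensor_tmul_key (A : FilteredRing A0) (L0 : Type u)
    [AddCommGroup L0] [Module A0 L0] (a : A.A1) (x : L0 ⊗[A0] A.A1) :
    (contractTensor A L0 x) ⊗ₜ[A0] a = A.τ a • x := by
  induction x with
  | zero => simp
  | tmul l b =>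
      rw [contractTensor_tmul, smul_tmul, A.symm b a, tmul_smul]
  | add x y hx hy =>
      rw [map_add, add_tmul, hx, hy, smul_add]

/-- The filtered module `(L₀ ⊗ A(0)) ⊕ (L₁ ⊗ A(1))`. -/
noncomputable def FilteredRing.ofPair (A : FilteredRing A0) (L0 L1 : Type u)
    [AddCommGroup L0] [AddCommGroup L1] [Module A0 L0] [Module A0 L1] :
    FilteredModule A where
  M0 := L0 × L1
  M1 := (L0 ⊗[A0] A.A1) × L1
  τM := (contractTensor A L0).prodMap LinearMap.id
  act a m := (m.1 ⊗ₜ[A0] a, A.τ a • m.2)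
  act_add_left a b m := by
    ext <;> simp [tmul_add, map_add, add_smul]
  act_add_right a m m' := by
    ext <;> simp [add_tmul, smul_add]
  act_smul_left r a m := by
    ext <;> simp [tmul_smul, map_smul, mul_smul]
  act_smul_right r a m := by
    ext <;> simp [smul_tmul', smul_comm r]
  τM_act a m := by
    ext <;> simp [contractTensor_tmul]
  act_τM a x := by
    ext
    · exact contractTensor_tmul_key A L0 a x.1
    · simp

/-- A bundled finite projective `A₀`-module. -/
structure FinProjMod (A0 : Type u) [CommRing A0] : Type (u + 1) where
  carrier : Type u
  [acg : AddCommGroup carrier]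
  [mod : Module A0 carrier]
  finite : Module.Finite A0 carrier
  projective : Module.Projective A0 carrier

attribute [instance] FinProjMod.acg FinProjMod.mod

/-- A filtered module is finite projective if it is a direct summand of a finite
direct sum of copies of `A(0)` and `A(1)`. -/
def FilteredModule.IsFiniteProjective {A : FilteredRing A0} (M : FilteredModule A) :
    Prop :=
  ∃ (m n : ℕ) (N : FilteredModule A),
    Nonempty (FilteredModuleEquiv (M.dsum N) (A.finFree m n))


theorem hens_exists_sep {A D : Type*} [CommRing A] [CommRing D] [Algebra A D] [Module.Finite A D]
    (I : Ideal A) (ρ : D) [Algebra.FormallyUnramified A (Localization.Away ρ)]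
    (σ : D →ₐ[A] A ⧸ I) (hρ : IsUnit (σ ρ)) :
    ∃ d : D, σ d = 1 ∧ ∀ x, σ x = 0 → d * x ∈ I.map (algebraMap A D) := by
  classical
  let Q := D ⧸ I.map (algebraMap A D)
  have hσI : ∀ x ∈ I.map (algebraMap A D), σ x = 0 := by
    intro x hx
    have : I.map (algebraMap A D) ≤ RingHom.ker σ := by
      rw [Ideal.map_le_iff_le_comap]
      intro a ha
      simp only [Ideal.mem_comap, RingHom.mem_ker, AlgHom.commutes]
      exact Ideal.Quotient.eq_zero_iff_mem.mpr ha
    exact this hx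
  let σb : Q →ₐ[A] A ⧸ I := Ideal.Quotient.liftₐ _ σ hσI
  let J : Ideal Q := RingHom.ker σb
  have hσb : ∀ x : D, σb (Ideal.Quotient.mk _ x) = σ x := fun x => rfl
  have hIQ : ∀ a ∈ I, algebraMap A Q a = 0 := by
    intro a ha
    exact Ideal.Quotient.eq_zero_iff_mem.mpr (Ideal.mem_map_of_mem _ ha)
  have hJfg : J.FG := by
    obtain ⟨n, y, hy⟩ := Module.Finite.exists_fin (R := A) (M := D)
    choose s hs using fun i => Ideal.Quotient.mk_surjective (σ (y i))
    let z : Fin n → Q := fun i => Ideal.Quotient.mk _ (y i) - algebraMap A Q (s i)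
    have hz : ∀ i, z i ∈ J := by
      intro i
      simp only [J, RingHom.mem_ker, z, map_sub, hσb, AlgHom.commutes]
      rw [← hs i]; simp
    refine ⟨Finset.univ.image z, ?_⟩
    apply le_antisymm
    · rw [Submodule.span_le]
      intro w hw
      simp only [Finset.coe_image, Finset.coe_univ, Set.image_univ, Set.mem_range] at hw
      obtain ⟨i, rfl⟩ := hw
      exact hz i
    · intro x hx
      obtain ⟨x, rfl⟩ := Ideal.Quotient.mk_surjective x
      have hx' : x ∈ Submodule.span A (Set.range y) := hy ▸ Submodule.mem_top
      obtain ⟨c, rfl⟩ := (Submodule.mem_span_range_iff_exists_fun A).mp hx'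
      have h1 : (Ideal.Quotient.mk _ (∑ i, c i • y i) : Q) =
          ∑ i, c i • z i + algebraMap A Q (∑ i, c i * s i) := by
        simp only [z, map_sum, map_mul, Algebra.smul_def, mul_sub, Finset.sum_sub_distrib,
          sub_add_cancel]
        rfl
      have h2 : ∑ i, c i • z i ∈ J := Submodule.sum_mem _ fun i _ => by
        rw [Algebra.smul_def]; exact Ideal.mul_mem_left _ _ (hz i)
      have h3 : algebraMap A Q (∑ i, c i * s i) ∈ J := by
        rw [h1] at hx; exact (Submodule.add_mem_iff_right _ h2).mp hx
      have h4 : ∑ i, c i * s i ∈ I := by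
        rw [← Ideal.Quotient.eq_zero_iff_mem]
        simpa [J, RingHom.mem_ker] using h3
      rw [h1, hIQ _ h4, add_zero]
      refine Submodule.sum_mem _ fun i _ => ?_
      rw [Algebra.smul_def]
      refine Ideal.mul_mem_left _ _ (Submodule.subset_span ?_)
      simp
  have hJ2 : IsIdempotentElem J := by
    let T := Q ⧸ J ^ 2
    let f : T →ₐ[A] A ⧸ I := Ideal.Quotient.liftₐ _ σb (fun x hx => by
      have := Ideal.pow_le_self two_ne_zero hx
      exact this)
    have hf : ∀ x : Q, f (Ideal.Quotient.mk _ x) = σb x := fun x => rfl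
    have hker : ∀ x y : T, f x = 0 → f y = 0 → x * y = 0 := by
      intro x y hx hy
      obtain ⟨x, rfl⟩ := Ideal.Quotient.mk_surjective x
      obtain ⟨y, rfl⟩ := Ideal.Quotient.mk_surjective y
      rw [← map_mul, Ideal.Quotient.eq_zero_iff_mem, pow_two]
      exact Ideal.mul_mem_mul hx hy
    have hkn : IsNilpotent (RingHom.ker (f : T →+* A ⧸ I)) := by
      have h2 : RingHom.ker (f : T →+* A ⧸ I) * RingHom.ker (f : T →+* A ⧸ I) = ⊥ := by
        rw [eq_bot_iff, Ideal.mul_le]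
        intro x hx y hy
        exact hker x y hx hy
      exact ⟨2, (pow_two (RingHom.ker (f : T →+* A ⧸ I))).trans h2⟩
    let π : D →ₐ[A] T := (Ideal.Quotient.mkₐ A (J ^ 2)).comp (Ideal.Quotient.mkₐ A _)
    have hfπ : ∀ x, f (π x) = σ x := fun x => rfl
    have hu : IsUnit (π ρ) := by
      obtain ⟨c, hc⟩ := hρ.exists_right_inv
      obtain ⟨c, rfl⟩ := Ideal.Quotient.mk_surjective c
      have : f (π ρ * algebraMap A T c - 1) = 0 := by
        simp only [map_sub, map_mul, hfπ, AlgHom.commutes, map_one]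
        rw [sub_eq_zero]; exact hc
      have h2 := hker _ _ this this
      refine IsUnit.of_mul_eq_one (algebraMap A T c * (2 - π ρ * algebraMap A T c)) ?_
      linear_combination -h2
    let g1 : Localization.Away ρ →ₐ[A] T := IsLocalization.Away.liftAlgHom (f := π) ρ hu
    let s' : Localization.Away ρ →ₐ[A] A ⧸ I := IsLocalization.Away.liftAlgHom (f := σ) ρ hρ
    let ι : (A ⧸ I) →ₐ[A] T := Ideal.Quotient.liftₐ I (Algebra.ofId A T) (fun a ha => by
      change Ideal.Quotient.mk _ (algebraMap A Q a) = 0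
      rw [hIQ a ha, map_zero])
    have hg : g1 = ι.comp s' := by
      refine Algebra.FormallyUnramified.lift_unique' f hkn _ _ ?_
      apply IsLocalization.algHom_ext (.powers ρ)
      have : f.comp ι = AlgHom.id A _ := by
        ext x
        obtain ⟨x, rfl⟩ := Ideal.Quotient.mk_surjective x
        exact (f.comp ι).commutes x
      rw [← AlgHom.comp_assoc, this]
      ext x
      simp [g1, s', Algebra.algHom, hfπ]
    apply le_antisymm Ideal.mul_le_left
    intro x hx
    obtain ⟨x, rfl⟩ := Ideal.Quotient.mk_surjective x
    have h := DFunLike.congr_fun hg (algebraMap D _ x)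
    have hx0 : σ x = 0 := hx
    simp [g1, s', hx0] at h
    rw [← pow_two]
    exact Ideal.Quotient.eq_zero_iff_mem.mp h
  obtain ⟨e, he, hJe⟩ := (Ideal.isIdempotentElem_iff_of_fg J hJfg).mp hJ2
  obtain ⟨d, hd⟩ := Ideal.Quotient.mk_surjective (1 - e)
  have heJ : e ∈ J := by rw [hJe]; exact Submodule.mem_span_singleton_self e
  refine ⟨d, ?_, ?_⟩
  · rw [← hσb, hd, map_sub, map_one]
    rw [show σb e = 0 from heJ, sub_zero]
  · intro x hx
    have hxJ : (Ideal.Quotient.mk _ x : Q) ∈ J := hx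
    rw [hJe] at hxJ
    obtain ⟨c, hc⟩ := Submodule.mem_span_singleton.mp hxJ
    rw [← Ideal.Quotient.eq_zero_iff_mem, map_mul, hd, ← hc, smul_eq_mul]
    have : e * e = e := he
    linear_combination (-c) * this



open Polynomial in
theorem hens_exists_poly {A D : Type*} [CommRing A] [CommRing D] [Algebra A D] [Module.Finite A D]
    (I : Ideal A) (σ : D →ₐ[A] A ⧸ I) (d : D) (hd1 : σ d = 1)
    (hd : ∀ x, σ x = 0 → d * x ∈ I.map (algebraMap A D)) :
    ∃ (n : ℕ) (P : A[X]), P.Monic ∧ aeval d P = 0 ∧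
      P.map (Ideal.Quotient.mk I) = (X - 1) * X ^ n := by
  classical
  obtain ⟨n, y, hy⟩ := Module.Finite.exists_fin (R := A) (M := D)
  have hI : ∀ x ∈ I.map (algebraMap A D), ∃ c : Fin n → A, (∀ i, c i ∈ I) ∧ ∑ i, c i • y i = x := by
    intro x hx
    have hx' : x ∈ (I • ⊤ : Submodule A D) := by
      rw [Ideal.smul_top_eq_map]; exact hx
    rw [← hy, Submodule.mem_ideal_smul_span_iff_exists_sum] at hx'
    obtain ⟨a, ha, rfl⟩ := hx'
    exact ⟨a, ha, (Finsupp.sum_fintype a (fun i c => c • y i) (fun i => zero_smul A (y i))).symm⟩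
  have key : ∀ (x : D) (s : A), Ideal.Quotient.mk I s = σ x →
      ∃ c : Fin n → A, (∀ i, c i ∈ I) ∧ s • d + ∑ i, c i • y i = d * x := by
    intro x s hs
    obtain ⟨c, hc, h⟩ := hI (d * (x - algebraMap A D s)) (hd _ (by
      rw [map_sub, AlgHom.commutes, ← hs]; simp))
    refine ⟨c, hc, ?_⟩
    rw [h, Algebra.smul_def]; ring
  obtain ⟨c1, hc1, h1⟩ := key d 1 (by rw [hd1, map_one])
  choose s hs using fun i => Ideal.Quotient.mk_surjective (σ (y i))
  choose c2 hc2 h2 using fun i => key (y i) (s i) (hs i)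
  let M : Matrix (Unit ⊕ Fin n) (Unit ⊕ Fin n) A :=
    Matrix.fromBlocks 1 (Matrix.of fun _ j => s j) (Matrix.of fun i _ => c1 i) (Matrix.of fun i j => c2 j i)
  let b : Unit ⊕ Fin n → D := Sum.elim (fun _ => d) y
  have hb : Submodule.span A (Set.range b) = ⊤ := by
    rw [eq_top_iff, ← hy]
    apply Submodule.span_mono
    rintro _ ⟨i, rfl⟩
    exact ⟨Sum.inr i, rfl⟩
  have hrep : M.Represents b (LinearMap.mulLeft A d) := by
    rw [Matrix.represents_iff']
    rintro (j | j)
    · simpa [M, b] using h1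
    · simpa [M, b] using h2 j
  refine ⟨n, M.charpoly, M.charpoly_monic, ?_, ?_⟩
  · let M' : Matrix.isRepresentation A b := ⟨M, _, hrep⟩
    have e1 : Matrix.isRepresentation.toEnd A b hb M' = LinearMap.mulLeft A d :=
      Matrix.isRepresentation.eq_toEnd_of_represents A b hb M' hrep
    have e2 : aeval M' M.charpoly = 0 := by
      apply Subtype.ext
      have := Matrix.aeval_self_charpoly M
      rw [← Subalgebra.coe_val, ← aeval_algHom_apply]
      simpa using this
    have e3 := congrArg (Matrix.isRepresentation.toEnd A b hb) e2
    rw [← aeval_algHom_apply, e1, map_zero] at e3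
    have e4 : aeval (Algebra.lmul A D d) M.charpoly = 0 := e3
    rw [aeval_algHom_apply] at e4
    simpa using LinearMap.congr_fun e4 1
  · rw [← Matrix.charpoly_map]
    have : M.map (Ideal.Quotient.mk I) =
        Matrix.fromBlocks 1 (Matrix.of fun _ j => Ideal.Quotient.mk I (s j)) 0 0 := by
      simp only [M, Matrix.fromBlocks_map]
      congr 1
      · ext i j; exact Ideal.Quotient.eq_zero_iff_mem.mpr (hc1 i)
      · ext i j; exact Ideal.Quotient.eq_zero_iff_mem.mpr (hc2 j i)
    rw [this, Matrix.charpoly_fromBlocks_zero₂₁]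
    simp [Matrix.charpoly_one, Matrix.charpoly_zero]

open Polynomial in
theorem hens_exists_idem {A D : Type*} [CommRing A] [CommRing D] [Algebra A D] [Module.Finite A D]
    (I : Ideal A) (hH : HenselianRing A I) (σ : D →ₐ[A] A ⧸ I) (d : D) (hd1 : σ d = 1)
    (hd : ∀ x, σ x = 0 → d * x ∈ I.map (algebraMap A D)) :
    ∃ ε : D, ε * ε = ε ∧ σ ε = 1 ∧ ∀ x, σ x = 0 → ε * x ∈ I.map (algebraMap A D) := by
  obtain ⟨n, P, hP, hPd, hPI⟩ := hens_exists_poly I σ d hd1 hd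
  have hloc := isLocalHom_of_le_jacobson_bot I hH.jac
  have hev : ∀ (Q : A[X]) (a : A), Ideal.Quotient.mk I (Q.eval a) =
      (Q.map (Ideal.Quotient.mk I)).eval (Ideal.Quotient.mk I a) := by
    intro Q a; rw [eval_map, eval₂_at_apply]
  obtain ⟨l, hl, hl1⟩ := hH.is_henselian P hP 1
    (by rw [← Ideal.Quotient.eq_zero_iff_mem, hev, hPI]; simp)
    (by rw [hev, ← derivative_map, hPI]; simp)
  have hl1' : Ideal.Quotient.mk I l = 1 := by
    rw [← sub_eq_zero, ← map_one (Ideal.Quotient.mk I), ← map_sub]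
    exact Ideal.Quotient.eq_zero_iff_mem.mpr hl1
  obtain ⟨Q, hQ⟩ := dvd_iff_isRoot.mpr hl
  have hQI : Q.map (Ideal.Quotient.mk I) = X ^ n := by
    have h := hPI
    rw [hQ, Polynomial.map_mul, Polynomial.map_sub, map_X, map_C, hl1', C_1] at h
    have hm : (X - 1 : (A ⧸ I)[X]).Monic := by simpa using monic_X_sub_C (1 : A ⧸ I)
    exact hm.isRegular.left h
  have hlu : IsUnit l := isUnit_of_map_unit (Ideal.Quotient.mk I) l (by rw [hl1']; exact isUnit_one)
  have hQl : Ideal.Quotient.mk I (Q.eval l) = 1 := by rw [hev, hQI, hl1']; simp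
  have hQu : IsUnit (Q.eval l) := isUnit_of_map_unit (Ideal.Quotient.mk I) _ (by
    rw [hQl]; exact isUnit_one)
  obtain ⟨w, hw⟩ := hQu.exists_right_inv
  obtain ⟨l', hl'⟩ := hlu.exists_right_inv
  set q : D := aeval d Q with hq
  have hdq : d * q = algebraMap A D l * q := by
    rw [hQ, map_mul, map_sub, aeval_X, aeval_C] at hPd
    linear_combination hPd
  have hqq : q * q = algebraMap A D (Q.eval l) * q := by
    obtain ⟨R, hR⟩ := X_sub_C_dvd_sub_C_eval (a := l) (p := Q)
    have := congrArg (aeval d) hR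
    rw [map_sub, map_mul, map_sub, aeval_X, aeval_C, aeval_C, ← hq] at this
    linear_combination q * this + (aeval d R) * hdq
  have hσq : σ q = 1 := by
    have h1 : σ q = aeval (σ d) Q := (aeval_algHom_apply σ d Q).symm
    rw [h1, hd1, aeval_def, eval₂_eq_eval_map]
    change eval 1 (Q.map (Ideal.Quotient.mk I)) = 1
    rw [hQI]; simp
  have hw' : algebraMap A D (Q.eval l) * algebraMap A D w = 1 := by rw [← map_mul, hw, map_one]
  have hl'' : algebraMap A D l * algebraMap A D l' = 1 := by rw [← map_mul, hl', map_one]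
  refine ⟨algebraMap A D w * q, ?_, ?_, ?_⟩
  · linear_combination (algebraMap A D w)^2 * hqq + (algebraMap A D w) * q * hw'
  · rw [map_mul, hσq, AlgHom.commutes, mul_one]
    have := congrArg (Ideal.Quotient.mk I) hw
    rw [map_mul, hQl, one_mul, map_one] at this
    exact this
  · intro x hx
    have : algebraMap A D w * q * x = (algebraMap A D w * algebraMap A D l' * q) * (d * x) := by
      linear_combination (-(algebraMap A D w) * algebraMap A D l' * x) * hdq - algebraMap A D w * q * x * hl''
    rw [this]
    exact Ideal.mul_mem_left _ _ (hd x hx)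


theorem hens_lift_etale {A D : Type*} [CommRing A] [CommRing D] [Algebra A D] [Module.Finite A D]
    [Algebra.FinitePresentation A D]
    (I : Ideal A) (hH : HenselianRing A I) (ρ : D) [Algebra.FormallyEtale A (Localization.Away ρ)]
    (σ' : Localization.Away ρ →ₐ[A] A ⧸ I) :
    ∃ φ' : Localization.Away ρ →ₐ[A] A, (Ideal.Quotient.mkₐ A I).comp φ' = σ' := by
  let σ : D →ₐ[A] A ⧸ I := σ'.comp (IsScalarTower.toAlgHom A D (Localization.Away ρ))
  have hρ : IsUnit (σ ρ) :=
    (IsLocalization.Away.algebraMap_isUnit (S := Localization.Away ρ) ρ).map σ'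
  obtain ⟨d, hd1, hd⟩ := hens_exists_sep I ρ σ hρ
  obtain ⟨ε, hεε, hε1, hε⟩ := hens_exists_idem I hH σ d hd1 hd
  have hloc := isLocalHom_of_le_jacobson_bot I hH.jac
  let B := D ⧸ Ideal.span {1 - ε}
  have hmkε : (Ideal.Quotient.mk _ ε : B) = 1 := by
    rw [← map_one (Ideal.Quotient.mk _), eq_comm, Ideal.Quotient.eq]
    exact Submodule.mem_span_singleton_self _
  let σB : B →ₐ[A] A ⧸ I := Ideal.Quotient.liftₐ _ σ (by
    intro x hx
    obtain ⟨c, rfl⟩ := Ideal.mem_span_singleton.mp hx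
    simp [hε1])
  have hσB : ∀ x : D, σB (Ideal.Quotient.mk _ x) = σ x := fun x => rfl
  have hsurj : Function.Surjective (algebraMap A B) := by
    have hle : (⊤ : Submodule A B) ≤ LinearMap.range (Algebra.linearMap A B) := by
      refine Submodule.le_of_le_smul_of_le_jacobson_bot (I := I) Module.Finite.fg_top hH.jac ?_
      intro x _
      obtain ⟨x, rfl⟩ := Ideal.Quotient.mk_surjective x
      obtain ⟨s, hs⟩ := Ideal.Quotient.mk_surjective (σ x)
      have h1 := hε (x - algebraMap A D s) (by
        rw [map_sub, AlgHom.commutes, ← hs]; simp)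
      have h2 : (Ideal.Quotient.mk _ x : B) = algebraMap A B s +
          Ideal.Quotient.mk _ (ε * (x - algebraMap A D s)) := by
        rw [map_mul, hmkε, one_mul, map_sub]
        change _ = Ideal.Quotient.mk _ (algebraMap A D s) + _
        ring
      rw [h2]
      refine Submodule.add_mem_sup ⟨s, rfl⟩ ?_
      rw [Ideal.smul_top_eq_map]
      have h3 := Ideal.mem_map_of_mem (Ideal.Quotient.mk (Ideal.span {1 - ε})) h1
      rw [Ideal.map_map] at h3
      exact h3
    intro b
    obtain ⟨a, ha⟩ := hle (Submodule.mem_top (x := b))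
    exact ⟨a, ha⟩
  have hρB : IsUnit (Ideal.Quotient.mk _ ρ : B) := by
    obtain ⟨a, ha⟩ := hsurj (Ideal.Quotient.mk _ ρ)
    rw [← ha]
    apply IsUnit.map
    apply isUnit_of_map_unit (Ideal.Quotient.mk I)
    have h := congrArg σB ha
    rw [AlgHom.commutes, hσB] at h
    change IsUnit (algebraMap A (A ⧸ I) a)
    rw [h]; exact hρ
  have : IsLocalization.Away ε B := IsLocalization.Away.quotient_of_isIdempotentElem hεε
  have : Algebra.FormallyEtale D B := Algebra.FormallyEtale.of_isLocalization (Submonoid.powers ε)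
  have : Algebra.FormallyEtale D (Localization.Away ρ) :=
    Algebra.FormallyEtale.of_isLocalization (Submonoid.powers ρ)
  let l : Localization.Away ρ →+* B := IsLocalization.Away.lift (g := algebraMap D B) ρ hρB
  letI : Algebra (Localization.Away ρ) B := l.toAlgebra
  have : IsScalarTower D (Localization.Away ρ) B := IsScalarTower.of_algebraMap_eq (fun x =>
    (IsLocalization.Away.lift_eq ρ hρB x).symm)
  have : IsScalarTower A (Localization.Away ρ) B := by
    refine IsScalarTower.of_algebraMap_eq (fun x => ?_)
    rw [IsScalarTower.algebraMap_apply A D (Localization.Away ρ),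
      ← IsScalarTower.algebraMap_apply D (Localization.Away ρ) B]
    rfl
  have : Algebra.FormallyEtale (Localization.Away ρ) B :=
    Algebra.FormallyEtale.of_restrictScalars (R := D)
  have : Algebra.FormallyEtale A B := Algebra.FormallyEtale.comp A (Localization.Away ρ) B
  have hid := (Algebra.FormallyEtale.iff_of_surjective hsurj).mp this
  have hBfp : Algebra.FinitePresentation A B :=
    Algebra.FinitePresentation.quotient ⟨{1 - ε}, by simp⟩
  have hfg : (RingHom.ker (algebraMap A B)).FG :=
    Algebra.FinitePresentation.ker_fG_of_surjective (Algebra.ofId A B) hsurj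
  have hKI : RingHom.ker (algebraMap A B) ≤ I := by
    intro a ha
    have h := congrArg σB (RingHom.mem_ker.mp ha)
    rw [AlgHom.commutes, map_zero] at h
    exact Ideal.Quotient.eq_zero_iff_mem.mp h
  have hK : RingHom.ker (algebraMap A B) = ⊥ := by
    refine Submodule.eq_bot_of_le_smul_of_le_jacobson_bot I _ hfg ?_ hH.jac
    calc RingHom.ker (algebraMap A B)
        = RingHom.ker (algebraMap A B) * RingHom.ker (algebraMap A B) := hid.symm
      _ ≤ I * RingHom.ker (algebraMap A B) := Ideal.mul_mono_left hKI
  let e : A ≃ₐ[A] B := AlgEquiv.ofBijective (Algebra.ofId A B)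
    ⟨(RingHom.injective_iff_ker_eq_bot (algebraMap A B)).mpr hK, hsurj⟩
  refine ⟨(e.symm : B →ₐ[A] A).comp (IsScalarTower.toAlgHom A (Localization.Away ρ) B), ?_⟩
  have h1 : (Ideal.Quotient.mkₐ A I).comp (e.symm : B →ₐ[A] A) = σB := by
    ext b
    obtain ⟨a, rfl⟩ := e.surjective b
    have : σB (e a) = Ideal.Quotient.mk I a := σB.commutes a
    rw [this]; simp
  rw [← AlgHom.comp_assoc, h1]
  apply IsLocalization.algHom_ext (.powers ρ)
  ext x
  change σB (algebraMap (Localization.Away ρ) B (algebraMap D _ x)) = σ x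
  rw [← IsScalarTower.algebraMap_apply D (Localization.Away ρ) B]
  rfl

open Polynomial in
theorem hens_factor {A : Type*} [CommRing A] (I : Ideal A) (hH : HenselianRing A I)
    (F : A[X]) (hF : F.Monic) (g0 h0 : (A ⧸ I)[X]) (hg : g0.Monic) (hh : h0.Monic)
    (hfac : F.map (Ideal.Quotient.mk I) = g0 * h0) (hco : IsCoprime g0 h0) :
    ∃ g h : A[X], F = g * h ∧ IsCoprime g h ∧ g.map (Ideal.Quotient.mk I) = g0 ∧
      h.map (Ideal.Quotient.mk I) = h0 := by
  rcases subsingleton_or_nontrivial (A ⧸ I) with hs | hn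
  · have : ∀ a : A, a = 0 := by
      have htop : I = ⊤ := Ideal.Quotient.subsingleton_iff.mp hs
      have h1 := hH.jac
      rw [htop, top_le_iff, Ideal.jacobson_eq_top_iff] at h1
      intro a
      have : a ∈ (⊥ : Ideal A) := h1 ▸ Submodule.mem_top
      simpa using this
    have : Subsingleton A := ⟨fun a b => by rw [this a, this b]⟩
    refine ⟨1, 1, Subsingleton.elim _ _, isCoprime_one_left, Subsingleton.elim _ _,
      Subsingleton.elim _ _⟩
  · let p : MonicDegreeEq A F.natDegree := MonicDegreeEq.mk F hF rfl
    have hdeg : F.natDegree = g0.natDegree + h0.natDegree := by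
      rw [← hg.natDegree_mul hh, ← hfac, hF.natDegree_map]
    let σ' := (UniversalCoprimeFactorizationRing.homEquiv (A ⧸ I) g0.natDegree h0.natDegree hdeg
      p).symm ⟨(MonicDegreeEq.mk g0 hg rfl, MonicDegreeEq.mk h0 hh rfl), hfac.symm, hco⟩
    obtain ⟨φ, hφ⟩ := hens_lift_etale I hH _ σ'
    have hq := (UniversalCoprimeFactorizationRing.homEquiv A g0.natDegree h0.natDegree hdeg p φ).2
    have hσ : UniversalCoprimeFactorizationRing.homEquiv (A ⧸ I) g0.natDegree h0.natDegree hdeg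
      p σ' = ⟨(MonicDegreeEq.mk g0 hg rfl, MonicDegreeEq.mk h0 hh rfl), hfac.symm, hco⟩ :=
      Equiv.apply_symm_apply _ _
    refine ⟨_, _, ?_, hq.2, ?_, ?_⟩
    · rw [hq.1]; simp [p]
    · have h1 := UniversalCoprimeFactorizationRing.homEquiv_comp_fst A g0.natDegree
        h0.natDegree hdeg p φ (Ideal.Quotient.mkₐ A I)
      rw [hφ, hσ] at h1
      exact (congrArg Subtype.val h1).symm
    · have h1 := UniversalCoprimeFactorizationRing.homEquiv_comp_snd A g0.natDegree
        h0.natDegree hdeg p φ (Ideal.Quotient.mkₐ A I)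
      rw [hφ, hσ] at h1
      exact (congrArg Subtype.val h1).symm

open Polynomial in
theorem aeval_mem_of_map_eq_zero {A M : Type*} [CommRing A] [AddCommGroup M] [Module A M]
    (I : Ideal A) (a : Module.End A M) (Z : A[X]) (hZ : Z.map (Ideal.Quotient.mk I) = 0) (x : M) :
    aeval a Z x ∈ (I • ⊤ : Submodule A M) := by
  rw [aeval_eq_sum_range, LinearMap.sum_apply]
  refine Submodule.sum_mem _ fun i _ => ?_
  rw [LinearMap.smul_apply]
  refine Submodule.smul_mem_smul ?_ Submodule.mem_top
  rw [← Ideal.Quotient.eq_zero_iff_mem, ← coeff_map, hZ, coeff_zero]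

open Polynomial in
theorem hens_lift_idem {A M : Type*} [CommRing A] (I : Ideal A) (hH : HenselianRing A I)
    [AddCommGroup M] [Module A M] [Module.Finite A M] (a : Module.End A M)
    (ha : ∀ x, a (a x) - a x ∈ (I • ⊤ : Submodule A M)) :
    ∃ e : Module.End A M, e * e = e ∧ ∀ x, e x - a x ∈ (I • ⊤ : Submodule A M) := by
  obtain ⟨q, hq, -, hqI, hq0⟩ :=
    LinearMap.exists_monic_and_natDegree_eq_and_coeff_mem_pow_and_aeval_eq_zero A (a * a - a) I
      (by rintro _ ⟨x, rfl⟩; exact ha x)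
  set n := q.natDegree with hn
  have hqX : q.map (Ideal.Quotient.mk I) = X ^ n := by
    ext k
    rw [coeff_map, coeff_X_pow]
    split_ifs with hk
    · rw [hk, hn, hq.coeff_natDegree, map_one]
    · rcases lt_or_gt_of_ne hk with h | h
      · exact Ideal.Quotient.eq_zero_iff_mem.mpr (Ideal.pow_le_self (by omega) (hqI k))
      · rw [coeff_eq_zero_of_natDegree_lt h, map_zero]
  let F : A[X] := (X * (X - 1)) * q.comp (X ^ 2 - X)
  have hX1 : (X - 1 : A[X]).Monic := by simpa using monic_X_sub_C (1 : A)
  have hX1' : (X - 1 : (A ⧸ I)[X]).Monic := by simpa using monic_X_sub_C (1 : A ⧸ I)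
  have hm : (X ^ 2 - X : A[X]).Monic := by
    rw [show (X ^ 2 - X : A[X]) = X * (X - 1) by ring]
    exact monic_X.mul hX1
  have hF : F.Monic := by
    rcases subsingleton_or_nontrivial A with hs | hs
    · exact Subsingleton.elim _ _
    · refine (monic_X.mul hX1).mul (hq.comp hm ?_)
      rw [show (X ^ 2 - X : A[X]) = X * (X - C 1) by rw [C_1]; ring,
        monic_X.natDegree_mul (monic_X_sub_C 1), natDegree_X, natDegree_X_sub_C]
      norm_num
  have hF0 : aeval a F = 0 := by
    simp only [F, map_mul, aeval_comp, map_sub, aeval_X, pow_two]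
    rw [hq0, mul_zero]
  have hFI : F.map (Ideal.Quotient.mk I) = (X - 1) ^ (n + 1) * X ^ (n + 1) := by
    simp only [F, Polynomial.map_mul, Polynomial.map_comp, hqX, Polynomial.map_sub, Polynomial.map_pow, map_X,
      Polynomial.map_one, X_pow_comp]
    rw [show (X ^ 2 - X : (A ⧸ I)[X]) = (X - 1) * X by ring, mul_pow]
    ring
  have hco : IsCoprime ((X - 1 : (A ⧸ I)[X]) ^ (n + 1)) (X ^ (n + 1)) :=
    IsCoprime.pow ⟨-1, 1, by ring⟩
  obtain ⟨g, h, hgh, ⟨u, v, huv⟩, hg, hh⟩ := hens_factor I hH F hF _ _ (hX1'.pow _)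
    (monic_X_pow _) hFI hco
  refine ⟨aeval a (v * h), ?_, ?_⟩
  · have h1 : v * h * (v * h) = v * h - (u * v) * F := by
      rw [hgh]; linear_combination (v * h) * huv
    rw [← map_mul, h1, map_sub, map_mul _ (u * v), hF0, mul_zero, sub_zero]
  · intro x
    let R : A[X] := - u * (X - 1) ^ n - v * X ^ n
    let Z : A[X] := v * h - X - (X ^ 2 - X) * R
    have hZ : Z.map (Ideal.Quotient.mk I) = 0 := by
      have h2 := congrArg (Polynomial.map (Ideal.Quotient.mk I)) huv
      simp only [Polynomial.map_add, Polynomial.map_mul, hg, hh, Polynomial.map_one] at h2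
      simp only [Z, R, Polynomial.map_mul, Polynomial.map_sub, Polynomial.map_pow, map_X,
        Polynomial.map_one, hh, Polynomial.map_neg]
      linear_combination X * h2
    have h3 : v * h - X = Z + (X ^ 2 - X) * R := by simp only [Z]; ring
    have h4 : aeval a (v * h) x - a x = aeval a (v * h - X) x := by
      rw [map_sub, aeval_X, LinearMap.sub_apply]
    rw [h4, h3, map_add, LinearMap.add_apply]
    refine Submodule.add_mem _ (aeval_mem_of_map_eq_zero I a Z hZ x) ?_
    rw [map_mul, map_sub, map_pow, aeval_X, pow_two]
    exact ha _

section FMHelpers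

/-- A map of finite modules congruent to the identity modulo an ideal in the radical. -/
theorem bijective_of_sub_mem {L : Type u} [AddCommGroup L] [Module A0 L] [Module.Finite A0 L]
    (I : Ideal A0) (hI : I ≤ Ideal.jacobson ⊥) (a : L →ₗ[A0] L)
    (ha : ∀ x, a x - x ∈ (I • ⊤ : Submodule A0 L)) : Function.Bijective a := by
  have hs : Function.Surjective a := by
    have hle : (⊤ : Submodule A0 L) ≤ LinearMap.range a := by
      refine Submodule.le_of_le_smul_of_le_jacobson_bot (I := I) Module.Finite.fg_top hI ?_
      intro x _
      have : x = a x + -(a x - x) := by abel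
      rw [this]
      exact Submodule.add_mem_sup ⟨x, rfl⟩ (Submodule.neg_mem _ (ha x))
    intro b
    exact hle (Submodule.mem_top (x := b))
  exact ⟨OrzechProperty.injective_of_surjective_endomorphism a hs, hs⟩

theorem map_mem_smul_top {L L' : Type u} [AddCommGroup L] [Module A0 L] [AddCommGroup L']
    [Module A0 L'] (I : Ideal A0) (f : L →ₗ[A0] L') {x : L} (hx : x ∈ (I • ⊤ : Submodule A0 L)) :
    f x ∈ (I • ⊤ : Submodule A0 L') := by
  have h : f x ∈ Submodule.map f (I • ⊤) := ⟨x, hx, rfl⟩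
  rw [Submodule.map_smul''] at h
  exact Submodule.smul_mono le_rfl le_top h

theorem block_bijective {X Y : Type u} [AddCommGroup X] [AddCommGroup Y] [Module A0 X]
    [Module A0 Y] (p : X ≃ₗ[A0] X) (q : Y →ₗ[A0] X) (r : X →ₗ[A0] Y) (s : Y →ₗ[A0] Y)
    (f : (X × Y) →ₗ[A0] (X × Y)) (hf : ∀ x y, f (x, y) = (p x + q y, r x + s y))
    (S : Y →ₗ[A0] Y) (hS : ∀ y, S y = s y - r (p.symm (q y))) (hb : Function.Bijective S) :
    Function.Bijective f := by
  constructor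
  · rw [injective_iff_map_eq_zero]
    rintro ⟨x, y⟩ h
    rw [hf, Prod.mk_eq_zero] at h
    have hx : x = - p.symm (q y) := by
      apply p.injective
      rw [map_neg, p.apply_symm_apply]
      exact eq_neg_of_add_eq_zero_left h.1
    have hy : S y = 0 := by
      rw [hS, ← h.2, hx, map_neg]; abel
    have hy0 : y = 0 := (injective_iff_map_eq_zero S).mp hb.1 y hy
    rw [hx, hy0]; simp
  · rintro ⟨x', y'⟩
    obtain ⟨y, hy⟩ := hb.2 (y' - r (p.symm x'))
    refine ⟨(p.symm (x' - q y), y), ?_⟩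
    rw [hf, p.apply_symm_apply, map_sub, map_sub]
    have h1 : s y = S y + r (p.symm (q y)) := by rw [hS]; abel
    rw [h1, hy]
    ext <;> simp

theorem summand_bijective {M P L : Type u} [AddCommGroup M] [AddCommGroup P] [AddCommGroup L]
    [Module A0 M] [Module A0 P] [Module A0 L] (i : M →ₗ[A0] P) (π : P →ₗ[A0] M)
    (i' : L →ₗ[A0] P) (π' : P →ₗ[A0] L) (h : ∀ x, π (i x) = x) (h' : ∀ x, π' (i' x) = x)
    (U : P →ₗ[A0] P)
    (hu : ∀ x, U x = x - i' (π' x) - i (π x) + (2 : A0) • i' (π' (i (π x))))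
    (hb : Function.Bijective U) : Function.Bijective (π' ∘ₗ i) := by
  constructor
  · rw [injective_iff_map_eq_zero]
    intro m hm
    rw [LinearMap.comp_apply] at hm
    have : U (i m) = 0 := by
      rw [hu, h, hm]; simp
    have := (injective_iff_map_eq_zero U).mp hb.1 _ this
    rw [← h m, this, map_zero]
  · intro l
    obtain ⟨z, hz⟩ := hb.2 (i' l)
    refine ⟨π z, ?_⟩
    rw [LinearMap.comp_apply, ← h' l, ← hz, hu]
    simp only [map_add, map_sub, map_smul, h', two_smul]
    abel

/-- Morphisms of filtered modules. -/
structure FMHom {A : FilteredRing A0} (M N : FilteredModule A) : Type u where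
  f0 : M.M0 →ₗ[A0] N.M0
  f1 : M.M1 →ₗ[A0] N.M1
  comm_τ : ∀ m, f0 (M.τM m) = N.τM (f1 m)
  comm_act : ∀ a m, f1 (M.act a m) = N.act a (f0 m)

/-- Composition. -/
def FMHom.comp {A : FilteredRing A0} {M N P : FilteredModule A} (g : FMHom N P) (f : FMHom M N) :
    FMHom M P where
  f0 := g.f0 ∘ₗ f.f0
  f1 := g.f1 ∘ₗ f.f1
  comm_τ m := by simp [f.comm_τ, g.comm_τ]
  comm_act a m := by simp [f.comm_act, g.comm_act]

/-- The action as a linear map. -/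
def actLin {A : FilteredRing A0} (M : FilteredModule A) (a : A.A1) : M.M0 →ₗ[A0] M.M1 where
  toFun := M.act a
  map_add' := M.act_add_right a
  map_smul' r m := M.act_smul_right r a m

/-- Homs underlying equivalences. -/
def FilteredModuleEquiv.toHom {A : FilteredRing A0} {M N : FilteredModule A}
    (e : FilteredModuleEquiv M N) : FMHom M N where
  f0 := e.e0
  f1 := e.e1
  comm_τ := e.comm_τ
  comm_act := e.comm_act

/-- Inverse. -/
def FilteredModuleEquiv.inv {A : FilteredRing A0} {M N : FilteredModule A}
    (e : FilteredModuleEquiv M N) : FilteredModuleEquiv N M where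
  e0 := e.e0.symm
  e1 := e.e1.symm
  comm_τ m := by
    apply e.e0.injective
    rw [e.comm_τ]; simp
  comm_act a m := by
    apply e.e1.injective
    rw [e.comm_act]; simp

/-- Composition of equivalences. -/
def FilteredModuleEquiv.tr {A : FilteredRing A0} {M N P : FilteredModule A}
    (e : FilteredModuleEquiv M N) (f : FilteredModuleEquiv N P) : FilteredModuleEquiv M P where
  e0 := e.e0.trans f.e0
  e1 := e.e1.trans f.e1
  comm_τ m := by simp [e.comm_τ, f.comm_τ]
  comm_act a m := by simp [e.comm_act, f.comm_act]

/-- Equivalence from a bijective hom. -/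
noncomputable def FMHom.toEquiv {A : FilteredRing A0} {M N : FilteredModule A} (f : FMHom M N)
    (h0 : Function.Bijective f.f0) (h1 : Function.Bijective f.f1) : FilteredModuleEquiv M N where
  e0 := LinearEquiv.ofBijective f.f0 h0
  e1 := LinearEquiv.ofBijective f.f1 h1
  comm_τ := f.comm_τ
  comm_act := f.comm_act

/-- Congruence of direct sums on the left. -/
def FilteredModuleEquiv.dsumLeft {A : FilteredRing A0} {M M' : FilteredModule A}
    (e : FilteredModuleEquiv M M') (N : FilteredModule A) :
    FilteredModuleEquiv (M.dsum N) (M'.dsum N) where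
  e0 := e.e0.prodCongr (LinearEquiv.refl A0 N.M0)
  e1 := e.e1.prodCongr (LinearEquiv.refl A0 N.M1)
  comm_τ m := Prod.ext (e.comm_τ m.1) rfl
  comm_act a m := Prod.ext (e.comm_act a m.1) rfl

/-- Inclusion of a summand. -/
def dsumInl {A : FilteredRing A0} (M N : FilteredModule A) : FMHom M (M.dsum N) where
  f0 := LinearMap.inl A0 M.M0 N.M0
  f1 := LinearMap.inl A0 M.M1 N.M1
  comm_τ m := Prod.ext rfl (map_zero N.τM).symm
  comm_act a m := Prod.ext rfl (map_zero (actLin N a)).symm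

/-- Projection to a summand. -/
def dsumFst {A : FilteredRing A0} (M N : FilteredModule A) : FMHom (M.dsum N) M where
  f0 := LinearMap.fst A0 M.M0 N.M0
  f1 := LinearMap.fst A0 M.M1 N.M1
  comm_τ m := rfl
  comm_act a m := rfl

theorem contract_rTensor (A : FilteredRing A0) {L L' : Type u} [AddCommGroup L] [Module A0 L]
    [AddCommGroup L'] [Module A0 L'] (f : L →ₗ[A0] L') (x : L ⊗[A0] A.A1) :
    contractTensor A L' (f.rTensor A.A1 x) = f (contractTensor A L x) := by
  induction x with
  | zero => simp
  | tmul l b => simp [contractTensor_tmul]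
  | add x y hx hy => simp only [map_add, hx, hy]

theorem contract_mem (A : FilteredRing A0) {L : Type u} [AddCommGroup L] [Module A0 L]
    (x : L ⊗[A0] A.A1) :
    contractTensor A L x ∈ ((LinearMap.range A.τ : Ideal A0) • ⊤ : Submodule A0 L) := by
  induction x with
  | zero => simp
  | tmul l b =>
      rw [contractTensor_tmul]
      exact Submodule.smul_mem_smul ⟨b, rfl⟩ Submodule.mem_top
  | add x y hx hy => rw [map_add]; exact Submodule.add_mem _ hx hy

section Pair

variable (A : FilteredRing A0) {L0 L1 L0' L1' : Type u}
    [AddCommGroup L0] [AddCommGroup L1] [Module A0 L0] [Module A0 L1]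
    [AddCommGroup L0'] [AddCommGroup L1'] [Module A0 L0'] [Module A0 L1']

/-- Diagonal map. -/
noncomputable def pairMap (f : L0 →ₗ[A0] L0') (g : L1 →ₗ[A0] L1') :
    FMHom (A.ofPair L0 L1) (A.ofPair L0' L1') where
  f0 := f.prodMap g
  f1 := (f.rTensor A.A1).prodMap g
  comm_τ m := Prod.ext (contract_rTensor A f m.1).symm rfl
  comm_act a m := Prod.ext rfl (map_smul g _ _)

/-- Diagonal equivalence. -/
noncomputable def pairCongr (f : L0 ≃ₗ[A0] L0') (g : L1 ≃ₗ[A0] L1') :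
    FilteredModuleEquiv (A.ofPair L0 L1) (A.ofPair L0' L1') where
  e0 := f.prodCongr g
  e1 := (f.rTensor A.A1).prodCongr g
  comm_τ m := Prod.ext (contract_rTensor A f.toLinearMap m.1).symm rfl
  comm_act a m := Prod.ext rfl (map_smul g _ _)

/-- Direct sums of pairs. -/
noncomputable def pairDsum :
    FilteredModuleEquiv ((A.ofPair L0 L1).dsum (A.ofPair L0' L1'))
      (A.ofPair (L0 × L0') (L1 × L1')) where
  e0 := LinearEquiv.prodProdProdComm A0 L0 L1 L0' L1'
  e1 := (LinearEquiv.prodProdProdComm A0 (L0 ⊗[A0] A.A1) L1 (L0' ⊗[A0] A.A1) L1').trans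
    ((TensorProduct.prodLeft A0 A0 L0 L0' A.A1).symm.prodCongr (LinearEquiv.refl A0 (L1 × L1')))
  comm_τ m := by
    obtain ⟨⟨x, y⟩, ⟨x', y'⟩⟩ := m
    refine Prod.ext ?_ rfl
    change (contractTensor A L0 x, contractTensor A L0' x') =
      contractTensor A (L0 × L0') ((TensorProduct.prodLeft A0 A0 L0 L0' A.A1).symm (x, x'))
    obtain ⟨z, hz⟩ := (TensorProduct.prodLeft A0 A0 L0 L0' A.A1).surjective (x, x')
    rw [← hz, LinearEquiv.symm_apply_apply]
    have hx : x = ((TensorProduct.prodLeft A0 A0 L0 L0' A.A1) z).1 := by rw [hz]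
    have hx' : x' = ((TensorProduct.prodLeft A0 A0 L0 L0' A.A1) z).2 := by rw [hz]
    rw [hx, hx']
    clear hz hx hx'
    induction z with
    | zero => simp
    | tmul l b =>
        obtain ⟨l, l'⟩ := l
        rw [TensorProduct.prodLeft_tmul]
        simp [contractTensor_tmul]
    | add z w hz hw => rw [map_add, map_add, ← hz, ← hw]; simp
  comm_act a m := by
    obtain ⟨⟨x, y⟩, ⟨x', y'⟩⟩ := m
    refine Prod.ext ?_ rfl
    change (TensorProduct.prodLeft A0 A0 L0 L0' A.A1).symm (x ⊗ₜ a, x' ⊗ₜ a) = (x, x') ⊗ₜ a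
    rw [LinearEquiv.symm_apply_eq, TensorProduct.prodLeft_tmul]

/-- Free pairs. -/
noncomputable def pairFree (m n : ℕ) :
    FilteredModuleEquiv (A.ofPair (Fin m → A0) (Fin n → A0)) (A.finFree m n) where
  e0 := LinearEquiv.refl A0 _
  e1 := ((TensorProduct.comm A0 (Fin m → A0) A.A1).trans
    (TensorProduct.piScalarRight A0 A0 A.A1 (Fin m))).prodCongr (LinearEquiv.refl A0 (Fin n → A0))
  comm_τ x := by
    obtain ⟨x, y⟩ := x
    refine Prod.ext ?_ rfl
    change contractTensor A (Fin m → A0) x = A.τ.compLeft (Fin m)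
      (TensorProduct.piScalarRight A0 A0 A.A1 (Fin m) (TensorProduct.comm A0 (Fin m → A0) A.A1 x))
    induction x with
    | zero => simp
    | tmul l b =>
        ext i
        simp [contractTensor_tmul, mul_comm]
    | add z w hz hw => simp only [map_add, hz, hw]
  comm_act a x := by
    obtain ⟨x, y⟩ := x
    refine Prod.ext ?_ rfl
    change (TensorProduct.piScalarRight A0 A0 A.A1 (Fin m)
      (TensorProduct.comm A0 (Fin m → A0) A.A1 (x ⊗ₜ a))) = fun i => x i • a
    ext i
    simp

end Pair

section Blocks

variable {A : FilteredRing A0} {L0 L1 L0' L1' K0 K1 : Type u}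
    [AddCommGroup L0] [AddCommGroup L1] [Module A0 L0] [Module A0 L1]
    [AddCommGroup L0'] [AddCommGroup L1'] [Module A0 L0'] [Module A0 L1']
    [AddCommGroup K0] [AddCommGroup K1] [Module A0 K0] [Module A0 K1]

/-- Degree zero part, with unfolded type. -/
def lin0 (v : FMHom (A.ofPair L0 L1) (A.ofPair L0' L1')) : (L0 × L1) →ₗ[A0] (L0' × L1') := v.f0

/-- Degree one part, with unfolded type. -/
def lin1 (v : FMHom (A.ofPair L0 L1) (A.ofPair L0' L1')) :
    ((L0 ⊗[A0] A.A1) × L1) →ₗ[A0] ((L0' ⊗[A0] A.A1) × L1') := v.f1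

/-- Block. -/
def blkA (v : FMHom (A.ofPair L0 L1) (A.ofPair L0' L1')) : L0 →ₗ[A0] L0' :=
  LinearMap.fst A0 L0' L1' ∘ₗ lin0 v ∘ₗ LinearMap.inl A0 L0 L1

/-- Block. -/
def blkC (v : FMHom (A.ofPair L0 L1) (A.ofPair L0' L1')) : L0 →ₗ[A0] L1' :=
  LinearMap.snd A0 L0' L1' ∘ₗ lin0 v ∘ₗ LinearMap.inl A0 L0 L1

/-- Block. -/
def blkB (v : FMHom (A.ofPair L0 L1) (A.ofPair L0' L1')) : L1 →ₗ[A0] (L0' ⊗[A0] A.A1) :=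
  LinearMap.fst A0 (L0' ⊗[A0] A.A1) L1' ∘ₗ lin1 v ∘ₗ LinearMap.inr A0 (L0 ⊗[A0] A.A1) L1

/-- Block. -/
def blkD (v : FMHom (A.ofPair L0 L1) (A.ofPair L0' L1')) : L1 →ₗ[A0] L1' :=
  LinearMap.snd A0 (L0' ⊗[A0] A.A1) L1' ∘ₗ lin1 v ∘ₗ LinearMap.inr A0 (L0 ⊗[A0] A.A1) L1

theorem lin0_apply (v : FMHom (A.ofPair L0 L1) (A.ofPair L0' L1')) (x : L0) (y : L1) :
    lin0 v (x, y) = (blkA v x + contractTensor A L0' (blkB v y), blkC v x + blkD v y) := by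
  have h1 : lin0 v (0, y) = (contractTensor A L0' (blkB v y), blkD v y) := by
    have h := v.comm_τ ((0, y) : (L0 ⊗[A0] A.A1) × L1)
    have h2 : (A.ofPair L0 L1).τM ((0, y) : (L0 ⊗[A0] A.A1) × L1) = ((0, y) : L0 × L1) :=
      Prod.ext (map_zero (contractTensor A L0)) rfl
    rw [h2] at h
    exact h
  have h3 : ((x, y) : L0 × L1) = (x, 0) + (0, y) := by simp
  rw [h3, map_add, h1]
  rfl

theorem lin1_apply (v : FMHom (A.ofPair L0 L1) (A.ofPair L0' L1')) (x : L0 ⊗[A0] A.A1) (y : L1) :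
    lin1 v (x, y) = ((blkA v).rTensor A.A1 x + blkB v y,
      blkC v (contractTensor A L0 x) + blkD v y) := by
  have h1 : lin1 v (x, 0) = ((blkA v).rTensor A.A1 x, blkC v (contractTensor A L0 x)) := by
    induction x with
    | zero =>
        rw [map_zero, map_zero, map_zero]
        exact map_zero (lin1 v)
    | tmul l b =>
        have h := v.comm_act b ((l, 0) : L0 × L1)
        have h2 : (A.ofPair L0 L1).act b ((l, 0) : L0 × L1) =
            ((l ⊗ₜ b, 0) : (L0 ⊗[A0] A.A1) × L1) := Prod.ext rfl (smul_zero _)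
        rw [h2] at h
        rw [contractTensor_tmul, LinearMap.rTensor_tmul, map_smul]
        exact h
    | add z w hz hw =>
        have h2 : ((z + w, 0) : (L0 ⊗[A0] A.A1) × L1) = (z, 0) + (w, 0) := by simp
        rw [h2, map_add, hz, hw]
        simp
  have h3 : ((x, y) : (L0 ⊗[A0] A.A1) × L1) = (x, 0) + (0, y) := by simp
  rw [h3, map_add, h1]
  rfl

theorem blkA_comp (v : FMHom (A.ofPair L0' L1') (A.ofPair K0 K1))
    (w : FMHom (A.ofPair L0 L1) (A.ofPair L0' L1')) (x : L0) :
    blkA (v.comp w) x - blkA v (blkA w x) ∈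
      ((LinearMap.range A.τ : Ideal A0) • ⊤ : Submodule A0 K0) := by
  have h : blkA (v.comp w) x = (lin0 v (blkA w x, blkC w x)).1 := rfl
  rw [h, lin0_apply, add_sub_cancel_left]
  exact contract_mem A _

theorem blkD_comp (v : FMHom (A.ofPair L0' L1') (A.ofPair K0 K1))
    (w : FMHom (A.ofPair L0 L1) (A.ofPair L0' L1')) (x : L1) :
    blkD (v.comp w) x - blkD v (blkD w x) ∈
      ((LinearMap.range A.τ : Ideal A0) • ⊤ : Submodule A0 K1) := by
  have h : blkD (v.comp w) x = (lin1 v (blkB w x, blkD w x)).2 := rfl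
  rw [h, lin1_apply, add_sub_cancel_right]
  exact map_mem_smul_top _ _ (contract_mem A _)

theorem lin_bijective (hI : (LinearMap.range A.τ : Ideal A0) ≤ Ideal.jacobson ⊥)
    [Module.Finite A0 L0] [Module.Finite A0 L1]
    (v : FMHom (A.ofPair L0 L1) (A.ofPair L0 L1))
    (ha : ∀ x, blkA v x - x ∈ ((LinearMap.range A.τ : Ideal A0) • ⊤ : Submodule A0 L0))
    (hd : ∀ x, blkD v x - x ∈ ((LinearMap.range A.τ : Ideal A0) • ⊤ : Submodule A0 L1)) :
    Function.Bijective v.f0 ∧ Function.Bijective v.f1 := by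
  let p : L0 ≃ₗ[A0] L0 := LinearEquiv.ofBijective (blkA v) (bijective_of_sub_mem _ hI _ ha)
  let S : L1 →ₗ[A0] L1 := blkD v -
    blkC v ∘ₗ p.symm.toLinearMap ∘ₗ contractTensor A L0 ∘ₗ blkB v
  have hS : Function.Bijective S := by
    refine bijective_of_sub_mem _ hI S fun x => ?_
    have : S x - x = (blkD v x - x) -
      (blkC v ∘ₗ p.symm.toLinearMap) (contractTensor A L0 (blkB v x)) := by
      simp only [S, LinearMap.sub_apply, LinearMap.comp_apply]; abel
    rw [this]
    exact Submodule.sub_mem _ (hd x) (map_mem_smul_top _ _ (contract_mem A _))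
  constructor
  · exact block_bijective p (contractTensor A L0 ∘ₗ blkB v) (blkC v) (blkD v) (lin0 v)
      (fun x y => lin0_apply v x y) S (fun y => rfl) hS
  · refine block_bijective (p.rTensor A.A1) (blkB v) (blkC v ∘ₗ contractTensor A L0) (blkD v)
      (lin1 v) (fun x y => lin1_apply v x y) S (fun y => ?_) hS
    have : contractTensor A L0 ((p.rTensor A.A1).symm (blkB v y)) =
        p.symm (contractTensor A L0 (blkB v y)) := contract_rTensor A p.symm.toLinearMap _
    rw [LinearMap.comp_apply, this]
    rfl

end Blocks

theorem pair_unique (A : FilteredRing A0)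
    (hI : (LinearMap.range A.τ : Ideal A0) ≤ Ideal.jacobson ⊥) {L0 L1 L0' L1' : Type u}
    [AddCommGroup L0] [AddCommGroup L1] [Module A0 L0] [Module A0 L1]
    [AddCommGroup L0'] [AddCommGroup L1'] [Module A0 L0'] [Module A0 L1']
    [Module.Finite A0 L0] [Module.Finite A0 L1] [Module.Finite A0 L0'] [Module.Finite A0 L1']
    (e : FilteredModuleEquiv (A.ofPair L0 L1) (A.ofPair L0' L1')) :
    Nonempty (L0 ≃ₗ[A0] L0') ∧ Nonempty (L1 ≃ₗ[A0] L1') := by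
  have h1 : ∀ x, blkA (e.inv.toHom.comp e.toHom) x = x := fun x =>
    congrArg Prod.fst (e.e0.symm_apply_apply ((x, 0) : L0 × L1))
  have h2 : ∀ x, blkA (e.toHom.comp e.inv.toHom) x = x := fun x =>
    congrArg Prod.fst (e.e0.apply_symm_apply ((x, 0) : L0' × L1'))
  have h3 : ∀ x, blkD (e.inv.toHom.comp e.toHom) x = x := fun x =>
    congrArg Prod.snd (e.e1.symm_apply_apply ((0, x) : (L0 ⊗[A0] A.A1) × L1))
  have h4 : ∀ x, blkD (e.toHom.comp e.inv.toHom) x = x := fun x =>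
    congrArg Prod.snd (e.e1.apply_symm_apply ((0, x) : (L0' ⊗[A0] A.A1) × L1'))
  have k1 := bijective_of_sub_mem _ hI (blkA e.inv.toHom ∘ₗ blkA e.toHom) (fun x => by
    have := Submodule.neg_mem _ (blkA_comp e.inv.toHom e.toHom x)
    rwa [neg_sub, h1] at this)
  have k2 := bijective_of_sub_mem _ hI (blkA e.toHom ∘ₗ blkA e.inv.toHom) (fun x => by
    have := Submodule.neg_mem _ (blkA_comp e.toHom e.inv.toHom x)
    rwa [neg_sub, h2] at this)
  have k3 := bijective_of_sub_mem _ hI (blkD e.inv.toHom ∘ₗ blkD e.toHom) (fun x => by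
    have := Submodule.neg_mem _ (blkD_comp e.inv.toHom e.toHom x)
    rwa [neg_sub, h3] at this)
  have k4 := bijective_of_sub_mem _ hI (blkD e.toHom ∘ₗ blkD e.inv.toHom) (fun x => by
    have := Submodule.neg_mem _ (blkD_comp e.toHom e.inv.toHom x)
    rwa [neg_sub, h4] at this)
  rw [LinearMap.coe_comp] at k1 k2 k3 k4
  exact ⟨⟨LinearEquiv.ofBijective (blkA e.toHom) ⟨k1.1.of_comp, k2.2.of_comp⟩⟩,
    ⟨LinearEquiv.ofBijective (blkD e.toHom) ⟨k3.1.of_comp, k4.2.of_comp⟩⟩⟩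

theorem pair_finiteProjective (A : FilteredRing A0) {L0 L1 : Type u}
    [AddCommGroup L0] [AddCommGroup L1] [Module A0 L0] [Module A0 L1]
    [Module.Finite A0 L0] [Module.Finite A0 L1] [Module.Projective A0 L0] [Module.Projective A0 L1]
    (M : FilteredModule A) (e : FilteredModuleEquiv M (A.ofPair L0 L1)) :
    M.IsFiniteProjective := by
  have key : ∀ (L : Type u) [AddCommGroup L] [Module A0 L] [Module.Finite A0 L]
      [Module.Projective A0 L], ∃ (n : ℕ) (K : Submodule A0 (Fin n → A0)),
      Nonempty ((L × K) ≃ₗ[A0] (Fin n → A0)) := by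
    intro L _ _ _ _
    obtain ⟨n, f, hf⟩ := Module.Finite.exists_fin' A0 L
    obtain ⟨s, hs⟩ := Module.projective_lifting_property f LinearMap.id hf
    have hs' : ∀ x, f (s x) = x := fun x => LinearMap.congr_fun hs x
    let g : (L × LinearMap.ker f) →ₗ[A0] (Fin n → A0) :=
      s.coprod (LinearMap.ker f).subtype
    refine ⟨n, LinearMap.ker f, ⟨LinearEquiv.ofBijective g ⟨?_, ?_⟩⟩⟩
    · rw [injective_iff_map_eq_zero]
      rintro ⟨x, ⟨k, hk⟩⟩ h
      have h' : s x + k = 0 := h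
      have hk' : f k = 0 := hk
      have hx : x = 0 := by
        have := congrArg f h'
        rwa [map_add, hs', hk', add_zero, map_zero] at this
      subst hx
      rw [map_zero, zero_add] at h'
      subst h'
      rfl
    · intro y
      refine ⟨(f y, ⟨y - s (f y), by simp [hs']⟩), ?_⟩
      simp [g]
  obtain ⟨m, K0, ⟨f0⟩⟩ := key L0
  obtain ⟨n, K1, ⟨f1⟩⟩ := key L1
  exact ⟨m, n, A.ofPair K0 K1, ⟨(e.dsumLeft _).tr ((pairDsum A).tr
    ((pairCongr A f0 f1).tr (pairFree A m n)))⟩⟩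

/-- The comparison endomorphism `1 - e' - e + 2 e' e`. -/
def compareHom {A : FilteredRing A0} {P : FilteredModule A} (v w : FMHom P P) : FMHom P P where
  f0 := LinearMap.id - v.f0 - w.f0 + (2 : A0) • (v.f0 ∘ₗ w.f0)
  f1 := LinearMap.id - v.f1 - w.f1 + (2 : A0) • (v.f1 ∘ₗ w.f1)
  comm_τ m := by
    simp [v.comm_τ, w.comm_τ]
  comm_act a m := by
    change _ = actLin P a _
    simp only [LinearMap.add_apply, LinearMap.sub_apply, LinearMap.smul_apply, LinearMap.comp_apply,
      LinearMap.id_apply, map_add, map_sub, map_smul, v.comm_act, w.comm_act]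
    rfl

theorem near_one {L : Type u} [AddCommGroup L] [Module A0 L] (J : Submodule A0 L)
    (x a' a t aa : L) (h1 : a' - a ∈ J) (h2 : t - aa ∈ J) (h3 : aa - a ∈ J) :
    (x - a' - a + (2 : A0) • t) - x ∈ J := by
  have : (x - a' - a + (2 : A0) • t) - x =
      (2 : A0) • (t - aa) + (2 : A0) • (aa - a) - (a' - a) := by
    simp only [two_smul]; abel
  rw [this]
  exact Submodule.sub_mem _ (Submodule.add_mem _ (Submodule.smul_mem _ _ h2)
    (Submodule.smul_mem _ _ h3)) h1

theorem exists_pair (A : FilteredRing A0) (hH : HenselianRing A0 (LinearMap.range A.τ))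
    (M : FilteredModule A) (hM : M.IsFiniteProjective) :
    ∃ L : FinProjMod A0 × FinProjMod A0,
      Nonempty (FilteredModuleEquiv M (A.ofPair L.1.carrier L.2.carrier)) := by
  obtain ⟨m, n, N, ⟨E⟩⟩ := hM
  let I : Ideal A0 := LinearMap.range A.τ
  let E' := E.tr (pairFree A m n).inv
  let i : FMHom M (A.ofPair (Fin m → A0) (Fin n → A0)) := E'.toHom.comp (dsumInl M N)
  let π : FMHom (A.ofPair (Fin m → A0) (Fin n → A0)) M := (dsumFst M N).comp E'.inv.toHom
  have hπ0 : ∀ x, π.f0 (i.f0 x) = x := fun x =>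
    congrArg Prod.fst (E'.e0.symm_apply_apply ((x, 0) : M.M0 × N.M0))
  have hπ1 : ∀ x, π.f1 (i.f1 x) = x := fun x =>
    congrArg Prod.fst (E'.e1.symm_apply_apply ((x, 0) : M.M1 × N.M1))
  let e := i.comp π
  have hAe : ∀ x, blkA (e.comp e) x = blkA e x := fun x =>
    congrArg (fun z => (i.f0 z : (Fin m → A0) × (Fin n → A0)).1) (hπ0 _)
  have hDe : ∀ x, blkD (e.comp e) x = blkD e x := fun x =>
    congrArg (fun z => (i.f1 z : ((Fin m → A0) ⊗[A0] A.A1) × (Fin n → A0)).2) (hπ1 _)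
  have ha : ∀ x, blkA e (blkA e x) - blkA e x ∈ (I • ⊤ : Submodule A0 (Fin m → A0)) := fun x => by
    have := Submodule.neg_mem _ (blkA_comp e e x)
    rwa [neg_sub, hAe] at this
  have hd : ∀ x, blkD e (blkD e x) - blkD e x ∈ (I • ⊤ : Submodule A0 (Fin n → A0)) := fun x => by
    have := Submodule.neg_mem _ (blkD_comp e e x)
    rwa [neg_sub, hDe] at this
  obtain ⟨a', haa, ha'⟩ := hens_lift_idem I hH (blkA e) ha
  obtain ⟨d', hdd, hd'⟩ := hens_lift_idem I hH (blkD e) hd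
  have hra : ∀ x, a'.rangeRestrict ((LinearMap.range a').subtype x) = x := by
    rintro ⟨_, x, rfl⟩
    exact Subtype.ext (LinearMap.congr_fun haa x)
  have hrd : ∀ x, d'.rangeRestrict ((LinearMap.range d').subtype x) = x := by
    rintro ⟨_, x, rfl⟩
    exact Subtype.ext (LinearMap.congr_fun hdd x)
  let i' := pairMap A (LinearMap.range a').subtype (LinearMap.range d').subtype
  let π' := pairMap A a'.rangeRestrict d'.rangeRestrict
  have hπ0' : ∀ x, π'.f0 (i'.f0 x) = x := fun x => Prod.ext (hra x.1) (hrd x.2)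
  have hπ1' : ∀ x, π'.f1 (i'.f1 x) = x := fun x => by
    refine Prod.ext ?_ (hrd x.2)
    change a'.rangeRestrict.rTensor A.A1 ((LinearMap.range a').subtype.rTensor A.A1 x.1) = x.1
    rw [← LinearMap.comp_apply, ← LinearMap.rTensor_comp]
    have : a'.rangeRestrict ∘ₗ (LinearMap.range a').subtype = LinearMap.id := LinearMap.ext hra
    rw [this, LinearMap.rTensor_id]
    rfl
  let v := compareHom (i'.comp π') e
  obtain ⟨hb0, hb1⟩ := lin_bijective hH.jac v
    (fun x => near_one _ x (a' x) (blkA e x) (a' (blkA e x)) (blkA e (blkA e x))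
      (ha' x) (ha' _) (ha x))
    (fun x => near_one _ x (d' x) (blkD e x) (d' (blkD e x)) (blkD e (blkD e x))
      (hd' x) (hd' _) (hd x))
  have H0 := summand_bijective i.f0 π.f0 i'.f0 π'.f0 hπ0 hπ0' v.f0 (fun x => rfl) hb0
  have H1 := summand_bijective i.f1 π.f1 i'.f1 π'.f1 hπ1 hπ1' v.f1 (fun x => rfl) hb1
  refine ⟨(⟨LinearMap.range a', inferInstance,
      Module.Projective.of_split (LinearMap.range a').subtype a'.rangeRestrict
        (LinearMap.ext hra)⟩,
    ⟨LinearMap.range d', inferInstance,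
      Module.Projective.of_split (LinearMap.range d').subtype d'.rangeRestrict
        (LinearMap.ext hrd)⟩), ⟨(π'.comp i).toEquiv H0 H1⟩⟩

end FMHelpers

/-- Classification of finite projective filtered modules over a Henselian filtered
ring (Lemma on the structure of filtered modules). -/
theorem finiteProjective_filteredModule_classification
    (A : FilteredRing A0) (hH : HenselianRing A0 (LinearMap.range A.τ)) :
    -- (1) finite projective filtered modules are exactly those of the form
    --     (L₀ ⊗ A(0)) ⊕ (L₁ ⊗ A(1)) with L₀, L₁ finite projective over A₀
    (∀ M : FilteredModule A,
        M.IsFiniteProjective ↔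
          ∃ L : FinProjMod A0 × FinProjMod A0,
            Nonempty (FilteredModuleEquiv M (A.ofPair L.1.carrier L.2.carrier))) ∧
    -- (2) the assignment (L₀, L₁) ↦ (L₀ ⊗ A(0)) ⊕ (L₁ ⊗ A(1)) is injective on
    --     isomorphism classes (together with (1), it is a bijection onto the
    --     isomorphism classes of finite projective filtered modules)
    (∀ L L' : FinProjMod A0 × FinProjMod A0,
        (Nonempty (L.1.carrier ≃ₗ[A0] L'.1.carrier) ∧
            Nonempty (L.2.carrier ≃ₗ[A0] L'.2.carrier)) ↔
          Nonempty (FilteredModuleEquiv (A.ofPair L.1.carrier L.2.carrier)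
            (A.ofPair L'.1.carrier L'.2.carrier))) := by
  refine ⟨fun M => ⟨exists_pair A hH M, ?_⟩, fun L L' => ⟨?_, ?_⟩⟩
  · rintro ⟨L, ⟨e⟩⟩
    have := L.1.finite
    have := L.1.projective
    have := L.2.finite
    have := L.2.projective
    exact pair_finiteProjective A M e
  · rintro ⟨⟨f⟩, ⟨g⟩⟩
    exact ⟨pairCongr A f g⟩
  · rintro ⟨e⟩
    have := L.1.finite
    have := L.2.finite
    have := L'.1.finite
    have := L'.2.finite
    exact pair_unique A hH.jac e
end

section
/- Let p be a prime and R a commutative ring of characteristic p. Then the ring W(R) of p-typical Witt vectors is Henselian along the ideal V(W(R)) given by the image of the Verschiebung; that is, V(W(R)) is contained in the Jacobson radical of W(R) and (W(R), V(W(R))) is a Henselian pair (Mathlib's HenselianRing). -/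
/-!
STATEMENT 10: Let p be a prime and R a commutative ring of characteristic p.  Then
the ring W(R) of p-typical Witt vectors is Henselian along the ideal V(W(R)) given
by the image of the Verschiebung; that is, V(W(R)) is contained in the Jacobson
radical of W(R) and (W(R), V(W(R))) is a Henselian pair.
-/

/-- The image of the Verschiebung, as an ideal of `W(R)`. -/
def verschiebungIdeal (p : ℕ) [hp : Fact p.Prime] (R : Type*) [CommRing R] :
    Ideal (WittVector p R) where
  carrier := Set.range (WittVector.verschiebung (p := p) (R := R))
  add_mem' := by
    rintro a b ⟨x, rfl⟩ ⟨y, rfl⟩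
    exact ⟨x + y, map_add _ _ _⟩
  zero_mem' := ⟨0, map_zero _⟩
  smul_mem' := by
    rintro c a ⟨x, rfl⟩
    refine ⟨x * WittVector.frobenius c, ?_⟩
    rw [WittVector.verschiebung_mul_frobenius, smul_eq_mul, mul_comm]

section Helpers

variable {p : ℕ} [hp : Fact p.Prime] {R : Type*} [CommRing R]

/-- The filtration of `W(R)` by the kernels of the truncation maps. -/
noncomputable def wittFil (p : ℕ) [hp : Fact p.Prime] (R : Type*) [CommRing R] (n : ℕ) :
    Ideal (WittVector p R) :=
  RingHom.ker (WittVector.truncate (p := p) (R := R) n)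

theorem mem_wittFil {n : ℕ} {x : WittVector p R} :
    x ∈ wittFil p R n ↔ ∀ i < n, x.coeff i = 0 :=
  WittVector.mem_ker_truncate n x

theorem wittFil_anti {m n : ℕ} (h : m ≤ n) : wittFil p R n ≤ wittFil p R m := by
  intro x hx
  rw [mem_wittFil] at hx ⊢
  exact fun i hi => hx i (hi.trans_le h)

theorem wittFil_eq_zero {x : WittVector p R} (h : ∀ n, x ∈ wittFil p R n) : x = 0 := by
  ext n
  rw [WittVector.zero_coeff]
  exact mem_wittFil.1 (h (n + 1)) n (Nat.lt_succ_self n)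

theorem wittFil_one : wittFil p R 1 = verschiebungIdeal p R := by
  ext x
  rw [mem_wittFil]
  constructor
  · intro h
    exact ⟨x.shift 1, (by simpa using WittVector.eq_iterate_verschiebung (n := 1) h : x = _).symm⟩
  · rintro ⟨y, rfl⟩ i hi
    obtain rfl : i = 0 := by omega
    exact WittVector.verschiebung_coeff_zero y

theorem wittFil_mul [CharP R p] {m n : ℕ} {x y : WittVector p R} (hx : x ∈ wittFil p R m)
    (hy : y ∈ wittFil p R n) : x * y ∈ wittFil p R (m + n) := by
  rw [mem_wittFil] at hx hy ⊢
  rw [WittVector.eq_iterate_verschiebung hx, WittVector.eq_iterate_verschiebung hy,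
    WittVector.iterate_verschiebung_mul]
  exact fun i hi => WittVector.iterate_verschiebung_coeff_eq_zero _ hi

theorem wittFil_pow [CharP R p] {x : WittVector p R} (hx : x ∈ wittFil p R 1) (n : ℕ) :
    x ^ n ∈ wittFil p R n := by
  induction n with
  | zero => exact mem_wittFil.2 (by simp)
  | succ n ih => rw [pow_succ]; exact wittFil_mul ih hx

theorem wittFil_limit (c : ℕ → WittVector p R)
    (hc : ∀ n, c (n + 1) - c n ∈ wittFil p R n) :
    ∃ a, ∀ n, a - c n ∈ wittFil p R n := by
  have h : ∀ m k, c (m + k) - c m ∈ wittFil p R m := by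
    intro m k
    induction k with
    | zero => simp
    | succ k ih =>
      have := (wittFil p R m).add_mem (wittFil_anti (Nat.le_add_right m k) (hc (m + k))) ih
      rwa [sub_add_sub_cancel] at this
  refine ⟨.mk p (fun n => (c (n + 1)).coeff n), fun n => ?_⟩
  rw [mem_wittFil, ← WittVector.le_coeff_eq_iff_le_sub_coeff_eq_zero]
  intro i hi
  obtain ⟨k, rfl⟩ := Nat.exists_eq_add_of_le (Nat.succ_le_of_lt hi)
  have := mem_wittFil.1 (h (i + 1) k)
  rw [← WittVector.le_coeff_eq_iff_le_sub_coeff_eq_zero] at this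
  exact (this i (Nat.lt_succ_self i)).symm

theorem isUnit_one_sub_of_mem [CharP R p] {x : WittVector p R} (hx : x ∈ wittFil p R 1) :
    IsUnit (1 - x) := by
  obtain ⟨s, hs⟩ := wittFil_limit (fun n => ∑ i ∈ Finset.range n, x ^ i) (fun n => by
    rw [Finset.sum_range_succ, add_sub_cancel_left]
    exact wittFil_pow hx n)
  refine IsUnit.of_mul_eq_one s (sub_eq_zero.1 (wittFil_eq_zero fun n => ?_))
  have h1 := (wittFil p R n).sub_mem ((wittFil p R n).mul_mem_left (1 - x) (hs n))
    (wittFil_pow hx n)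
  have h2 := mul_neg_geom_sum x n
  convert h1 using 1
  rw [mul_sub, h2]
  ring

theorem verschiebungIdeal_le_jacobson [CharP R p] :
    verschiebungIdeal p R ≤ Ideal.jacobson ⊥ := by
  intro x hx
  rw [← wittFil_one] at hx
  rw [Ideal.mem_jacobson_bot]
  intro y
  have := isUnit_one_sub_of_mem ((wittFil p R 1).neg_mem ((wittFil p R 1).mul_mem_right y hx))
  rwa [sub_neg_eq_add, add_comm] at this

open Polynomial in
theorem wittVector_newton [CharP R p] (f : (WittVector p R)[X]) (a₀ : WittVector p R)
    (h₁ : f.eval a₀ ∈ wittFil p R 1)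
    (hu : ∀ b, b - a₀ ∈ wittFil p R 1 → IsUnit (f.derivative.eval b)) :
    ∃ a, f.IsRoot a ∧ a - a₀ ∈ wittFil p R 1 := by
  let c : ℕ → WittVector p R := fun n =>
    Nat.recOn n a₀ fun _ b => b - f.eval b * Ring.inverse (f.derivative.eval b)
  have hc : ∀ n, c (n + 1) = c n - f.eval (c n) * Ring.inverse (f.derivative.eval (c n)) :=
    fun n => rfl
  have key : ∀ n, c n - a₀ ∈ wittFil p R 1 ∧ f.eval (c n) ∈ wittFil p R (n + 1) := by
    intro n
    induction n with
    | zero => exact ⟨by simp [c], h₁⟩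
    | succ n ih =>
      obtain ⟨ih1, ih2⟩ := ih
      set e := f.eval (c n) * Ring.inverse (f.derivative.eval (c n)) with he
      have hee : e ∈ wittFil p R (n + 1) := Ideal.mul_mem_right _ _ ih2
      constructor
      · rw [hc, sub_right_comm]
        exact Ideal.sub_mem _ ih1 (wittFil_anti (by omega) hee)
      · obtain ⟨k, hk⟩ := f.binomExpansion (c n) (-e)
        have h0 : f.eval (c n) + f.derivative.eval (c n) * -e = 0 := by
          rw [he, mul_neg, mul_left_comm, Ring.mul_inverse_cancel _ (hu _ ih1)]
          ring
        rw [hc, sub_eq_add_neg, hk, h0, zero_add, neg_sq, sq]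
        exact Ideal.mul_mem_left _ _ (wittFil_anti (by omega) (wittFil_mul hee hee))
  have hstep : ∀ n, c (n + 1) - c n ∈ wittFil p R (n + 1) := by
    intro n
    rw [hc, sub_sub_cancel_left]
    exact Ideal.neg_mem_iff _ |>.2 (Ideal.mul_mem_right _ _ (key n).2)
  obtain ⟨a, ha⟩ := wittFil_limit c fun n => wittFil_anti (Nat.le_succ n) (hstep n)
  refine ⟨a, wittFil_eq_zero fun n => ?_, ?_⟩
  · have h := Ideal.mem_of_dvd _ (f.sub_dvd_eval_sub a (c n)) (ha n)
    have := Ideal.add_mem _ h (wittFil_anti (Nat.le_succ n) (key n).2)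
    rwa [sub_add_cancel] at this
  · have := Ideal.add_mem _ (ha 1) (key 1).1
    rwa [sub_add_sub_cancel] at this

end Helpers

theorem wittVector_henselian_along_verschiebung (p : ℕ) [hp : Fact p.Prime]
    (R : Type*) [CommRing R] [CharP R p] :
    verschiebungIdeal p R ≤ Ideal.jacobson ⊥ ∧
    HenselianRing (WittVector p R) (verschiebungIdeal p R) := by
  refine ⟨verschiebungIdeal_le_jacobson, verschiebungIdeal_le_jacobson, ?_⟩
  intro f _ a₀ h₁ h₂
  have hloc := isLocalHom_of_le_jacobson_bot (verschiebungIdeal p R)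
    verschiebungIdeal_le_jacobson
  have hu : ∀ b, b - a₀ ∈ wittFil p R 1 → IsUnit (f.derivative.eval b) := by
    intro b hb
    rw [wittFil_one] at hb
    apply IsUnit.of_map (Ideal.Quotient.mk (verschiebungIdeal p R))
    have : Ideal.Quotient.mk (verschiebungIdeal p R) (f.derivative.eval b) =
        Ideal.Quotient.mk (verschiebungIdeal p R) (f.derivative.eval a₀) :=
      Ideal.Quotient.eq.2 (Ideal.mem_of_dvd _ (f.derivative.sub_dvd_eval_sub b a₀) hb)
    rwa [this]
  have := wittVector_newton f a₀ (by rwa [wittFil_one]) hu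
  rwa [wittFil_one] at this
end

section
/- Let p be a prime and let R be a commutative ring in which p is nilpotent. Then there exists a divided power structure γ on the ideal V(W(R)) ⊆ W(R) (the image of the Verschiebung) such that (p−1)! · γ_p(V(x)) = p^{p−2} · V(x^p) for all x ∈ W(R). -/
open WittVector in
/-- A power of `p` in `W(R)` lies in `V^n W(R)`. -/
theorem pow_p_mem_iterate_verschiebung (p : ℕ) [hp : Fact p.Prime] (R : Type*) [CommRing R]
    (hR : IsNilpotent (p : R)) (n : ℕ) :
    ∃ (k : ℕ) (a : WittVector p R), (p : WittVector p R) ^ k = (verschiebung^[n]) a := by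
  obtain ⟨N, hN⟩ := hR
  induction n with
  | zero => exact ⟨0, 1, by simp⟩
  | succ n ih =>
    obtain ⟨k, a, ha⟩ := ih
    have hmul : ∀ (m : ℕ) (b : WittVector p R),
        (m : WittVector p R) * (verschiebung^[n]) b = (verschiebung^[n]) ((m : WittVector p R) * b) := by
      intro m b
      have := iterate_verschiebung_mul_left b (m : WittVector p R) n
      rw [mul_comm, this, mul_comm]
      congr 2
      clear this ha
      induction n with
      | zero => rfl
      | succ n ih => rw [Function.iterate_succ_apply', ih, map_natCast]
    have h0 : ((p : WittVector p R) ^ N * a).coeff 0 = 0 := by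
      rw [mul_coeff_zero]
      have : ((p : WittVector p R) ^ N).coeff 0 = 0 := by
        have := map_pow (constantCoeff (p := p) (R := R)) (p : WittVector p R) N
        rw [map_natCast, hN] at this
        exact this
      rw [this, zero_mul]
    refine ⟨N + k, ((p : WittVector p R) ^ N * a).shift 1, ?_⟩
    rw [pow_add, ha, Function.iterate_succ_apply]
    have h1 := hmul (p ^ N) a
    push_cast at h1
    rw [h1]
    congr 1
    ext i
    cases i with
    | zero => rw [h0, verschiebung_coeff_zero]
    | succ i => rw [verschiebung_coeff_succ, shift_coeff, add_comm]

/-- `p` is nilpotent in the truncated Witt vectors. -/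
theorem truncated_p_nilpotent (p : ℕ) [hp : Fact p.Prime] (R : Type*) [CommRing R]
    (hR : IsNilpotent (p : R)) (n : ℕ) : IsNilpotent (p : TruncatedWittVector p n R) := by
  obtain ⟨k, a, h⟩ := pow_p_mem_iterate_verschiebung p R hR n
  refine ⟨k, ?_⟩
  have h2 : WittVector.truncate n ((p : WittVector p R) ^ k) = 0 := by
    rw [h, ← RingHom.mem_ker, WittVector.mem_ker_truncate]
    intro i hi
    exact WittVector.iterate_verschiebung_coeff_eq_zero a hi
  rwa [map_pow, map_natCast] at h2

/-- Integers prime to `p` are units in a ring where `p` is nilpotent. -/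
theorem isUnit_intCast_of_nilpotent (p : ℕ) [hp : Fact p.Prime] (T : Type*) [CommRing T]
    (hT : IsNilpotent (p : T)) (m : ℤ) (hm : ¬ (p : ℤ) ∣ m) : IsUnit (m : T) := by
  obtain ⟨N, hN⟩ := hT
  have hc : IsCoprime ((p : ℤ) ^ N) m :=
    ((Nat.prime_iff_prime_int.mp hp.out).coprime_iff_not_dvd.mpr hm).pow_left
  obtain ⟨u, v, huv⟩ := hc
  have h := congrArg (Int.cast : ℤ → T) huv
  push_cast at h
  rw [hN, mul_zero, zero_add] at h
  exact IsUnit.of_mul_eq_one_right _ h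

instance spanIntPrime (p : ℕ) [hp : Fact p.Prime] : (Ideal.span {(p : ℤ)}).IsPrime :=
  (Ideal.span_singleton_prime (by exact_mod_cast hp.out.ne_zero)).mpr
    (Nat.prime_iff_prime_int.mp hp.out)

/-- `W(R)` is a `ℤ_(p)`-algebra when `p` is nilpotent in `R`. -/
theorem exists_hom_localization (p : ℕ) [hp : Fact p.Prime] (R : Type*) [CommRing R]
    (hR : IsNilpotent (p : R)) :
    Nonempty (Localization.AtPrime (Ideal.span {(p : ℤ)}) →+* WittVector p R) := by
  have hu : ∀ (n : ℕ) (y : (Ideal.span {(p : ℤ)}).primeCompl),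
      IsUnit (Int.castRingHom (TruncatedWittVector p n R) y) := by
    intro n y
    refine isUnit_intCast_of_nilpotent p _ (truncated_p_nilpotent p R hR n) _ ?_
    intro h
    exact y.2 (Ideal.mem_span_singleton.mpr h)
  refine ⟨WittVector.lift (fun n => IsLocalization.lift (hu n)) ?_⟩
  intro k₁ k₂ hk
  apply IsLocalization.ringHom_ext (Ideal.span {(p : ℤ)}).primeCompl
  exact RingHom.ext_int _ _

/-- The constants `p^(n-1)/n!` exist in `ℤ_(p)`. -/
theorem exists_coeff_localization (p : ℕ) [hp : Fact p.Prime] (n : ℕ) (hn : n ≠ 0) :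
    ∃ c : Localization.AtPrime (Ideal.span {(p : ℤ)}),
      (n.factorial : Localization.AtPrime (Ideal.span {(p : ℤ)})) * c = (p : _) ^ (n - 1) := by
  obtain ⟨e, m, hm, h⟩ := Nat.exists_eq_pow_mul_and_not_dvd n.factorial_ne_zero p hp.out.ne_one
  have hlt := padicValNat_factorial_lt_of_ne_zero p hn
  have he : e ≤ padicValNat p n.factorial :=
    (padicValNat_dvd_iff_le n.factorial_ne_zero).mp ⟨m, h⟩
  have hmu : IsUnit (m : Localization.AtPrime (Ideal.span {(p : ℤ)})) := by
    have hmem : (m : ℤ) ∈ (Ideal.span {(p : ℤ)}).primeCompl := by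
      intro h
      exact hm (by exact_mod_cast Ideal.mem_span_singleton.mp h)
    have := IsLocalization.map_units (Localization.AtPrime (Ideal.span {(p : ℤ)}))
      (⟨_, hmem⟩ : (Ideal.span {(p : ℤ)}).primeCompl)
    simpa using this
  obtain ⟨u, hu⟩ := hmu.exists_right_inv
  refine ⟨(p : _) ^ (n - 1 - e) * u, ?_⟩
  have hpe : n - 1 = e + (n - 1 - e) := by omega
  rw [h]
  conv_rhs => rw [hpe, pow_add]
  push_cast
  linear_combination ((p : Localization.AtPrime (Ideal.span {(p : ℤ)})) ^ e *
    (p : Localization.AtPrime (Ideal.span {(p : ℤ)})) ^ (n - 1 - e)) * hu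

/-- The identities satisfied by `p^(n-1)/n!` in a characteristic zero domain. -/
theorem coeff_identities (p : ℕ) [hp : Fact p.Prime] (S : Type*) [CommRing S] [IsDomain S]
    [CharZero S] (c : ℕ → S) (hc : ∀ n, n ≠ 0 → (n.factorial : S) * c n = (p : S) ^ (n - 1)) :
    c 1 = 1 ∧
      (∀ m n, m ≠ 0 → n ≠ 0 → c m * c n * (p : S) = ((m + n).choose m : S) * c (m + n)) ∧
      (∀ m n, m ≠ 0 → n ≠ 0 → c n ^ m * c m = (Nat.uniformBell m n : S) * c (m * n)) ∧
      ((p - 1).factorial : S) * c p = (p : S) ^ (p - 2) := by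
  have hf : ∀ n : ℕ, (n.factorial : S) ≠ 0 := fun n => by exact_mod_cast n.factorial_ne_zero
  refine ⟨by simpa using hc 1 one_ne_zero, ?_, ?_, ?_⟩
  · intro m n hm hn
    apply mul_left_cancel₀ (mul_ne_zero (hf m) (hf n))
    have h1 := hc m hm
    have h2 := hc n hn
    have h3 := hc (m + n) (by omega)
    have h4 : ((m + n).choose m : S) * m.factorial * n.factorial = (m + n).factorial := by
      rw [Nat.choose_symm_add]
      exact_mod_cast Nat.add_choose_mul_factorial_mul_factorial m n
    have h5 : (p : S) ^ (m + n - 1) = (p : S) ^ (m - 1) * (p : S) ^ (n - 1) * p := by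
      rw [← pow_add, ← pow_succ]; congr 1; omega
    calc (m.factorial : S) * n.factorial * (c m * c n * p)
        = (m.factorial * c m) * (n.factorial * c n) * p := by ring
      _ = (m + n).factorial * c (m + n) := by rw [h1, h2, h3, h5]
      _ = _ := by rw [← h4]; ring
  · intro m n hm hn
    apply mul_left_cancel₀ (mul_ne_zero (pow_ne_zero m (hf n)) (hf m))
    have h1 := hc m hm
    have h2 := hc n hn
    have h3 := hc (m * n) (mul_ne_zero hm hn)
    have h4 : (Nat.uniformBell m n : S) * (n.factorial : S) ^ m * m.factorial
        = (m * n).factorial := by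
      exact_mod_cast Nat.uniformBell_mul_eq m hn
    have h5 : (p : S) ^ (m * n - 1) = ((p : S) ^ (n - 1)) ^ m * (p : S) ^ (m - 1) := by
      rw [← pow_mul, ← pow_add]; congr 1
      obtain ⟨a, rfl⟩ := Nat.exists_eq_succ_of_ne_zero hm
      obtain ⟨b, rfl⟩ := Nat.exists_eq_succ_of_ne_zero hn
      simp only [Nat.succ_eq_add_one, Nat.add_sub_cancel]
      have : (a + 1) * (b + 1) = b * (a + 1) + a + 1 := by ring
      omega
    calc (n.factorial : S) ^ m * m.factorial * (c n ^ m * c m)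
        = (n.factorial * c n) ^ m * (m.factorial * c m) := by ring
      _ = (m * n).factorial * c (m * n) := by rw [h1, h2, h3, h5]
      _ = _ := by rw [← h4]; ring
  · have hp0 : (p : S) ≠ 0 := by exact_mod_cast hp.out.ne_zero
    apply mul_left_cancel₀ hp0
    have h1 := hc p hp.out.ne_zero
    have h2 : (p : S) * ((p - 1).factorial : S) = p.factorial := by
      exact_mod_cast Nat.mul_factorial_pred hp.out.ne_zero
    rw [← mul_assoc, h2, h1, ← pow_succ']
    congr 1
    have := hp.out.two_le
    omega

/-- The constants `p^(n-1)/n!` in `W(R)`, with the identities they satisfy. -/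
theorem exists_coeffs (p : ℕ) [hp : Fact p.Prime] (R : Type*) [CommRing R]
    (hR : IsNilpotent (p : R)) :
    ∃ c : ℕ → WittVector p R, c 1 = 1 ∧
      (∀ m n, m ≠ 0 → n ≠ 0 → c m * c n * (p : WittVector p R)
        = ((m + n).choose m : WittVector p R) * c (m + n)) ∧
      (∀ m n, m ≠ 0 → n ≠ 0 → c n ^ m * c m
        = (Nat.uniformBell m n : WittVector p R) * c (m * n)) ∧
      ((p - 1).factorial : WittVector p R) * c p = (p : WittVector p R) ^ (p - 2) := by
  obtain ⟨φ⟩ := exists_hom_localization p R hR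
  have hinj : Function.Injective
      (algebraMap ℤ (Localization.AtPrime (Ideal.span {(p : ℤ)}))) :=
    IsLocalization.injective _
      (Ideal.primeCompl_le_nonZeroDivisors (Ideal.span {(p : ℤ)}))
  have : IsDomain (Localization.AtPrime (Ideal.span {(p : ℤ)})) :=
    IsLocalization.isDomain_localization
      (Ideal.primeCompl_le_nonZeroDivisors (Ideal.span {(p : ℤ)}))
  have : CharZero (Localization.AtPrime (Ideal.span {(p : ℤ)})) :=
    charZero_of_injective_algebraMap hinj
  have hex := exists_coeff_localization p
  choose! c hc using hex
  obtain ⟨h1, h2, h3, h4⟩ := coeff_identities p _ c hc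
  refine ⟨fun n => φ (c n), by simp [h1], fun m n hm hn => ?_, fun m n hm hn => ?_, ?_⟩
  · simpa using congrArg φ (h2 m n hm hn)
  · simpa using congrArg φ (h3 m n hm hn)
  · simpa using congrArg φ h4

open WittVector

theorem mul_versch (p : ℕ) [hp : Fact p.Prime] {R : Type*} [CommRing R] (a x : WittVector p R) :
    a * verschiebung x = verschiebung (frobenius a * x) := by
  rw [mul_comm (frobenius a), verschiebung_mul_frobenius, mul_comm]

theorem versch_mul_versch (p : ℕ) [hp : Fact p.Prime] {R : Type*} [CommRing R]
    (x y : WittVector p R) :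
    verschiebung x * verschiebung y = (p : WittVector p R) * verschiebung (x * y) := by
  rw [mul_versch, frobenius_verschiebung, mul_versch, map_natCast]
  congr 1; ring

open Classical in
/-- The divided powers, as a function depending on constants `c`. -/
noncomputable def wittDpow (p : ℕ) [hp : Fact p.Prime] (R : Type*) [CommRing R]
    (c : ℕ → WittVector p R) (n : ℕ) (y : WittVector p R) : WittVector p R :=
  if h : ∃ x, verschiebung x = y then
    if n = 0 then 1 else c n * verschiebung (h.choose ^ n) else 0

theorem wittDpow_zero (p : ℕ) [hp : Fact p.Prime] (R : Type*) [CommRing R]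
    (c : ℕ → WittVector p R) (x : WittVector p R) :
    wittDpow p R c 0 (verschiebung x) = 1 := by
  simp [wittDpow]

theorem wittDpow_pos (p : ℕ) [hp : Fact p.Prime] (R : Type*) [CommRing R]
    (c : ℕ → WittVector p R) {n : ℕ} (hn : n ≠ 0) (x : WittVector p R) :
    wittDpow p R c n (verschiebung x) = c n * verschiebung (x ^ n) := by
  have h : ∃ x', verschiebung x' = verschiebung x := ⟨x, rfl⟩
  have h2 : h.choose = x := verschiebung_injective p R h.choose_spec
  rw [wittDpow, dif_pos h, if_neg hn, h2]

theorem wittVector_dividedPowers_verschiebung (p : ℕ) [hp : Fact p.Prime]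
    (R : Type*) [CommRing R] (hR : IsNilpotent (p : R)) :
    ∃ γ : DividedPowers (verschiebungIdeal p R),
      ∀ x : WittVector p R,
        ((p - 1).factorial : WittVector p R) * γ.dpow p (WittVector.verschiebung x) =
          (p : WittVector p R) ^ (p - 2) * WittVector.verschiebung (x ^ p) := by
  classical
  obtain ⟨c, h1, h2, h3, h4⟩ := exists_coeffs p R hR
  have hmulpos : ∀ (m n : ℕ) (x y : WittVector p R), m ≠ 0 → n ≠ 0 →
      wittDpow p R c m (verschiebung x) * wittDpow p R c n (verschiebung y) =
        ((m + n).choose m : WittVector p R) * (c (m + n) * verschiebung (x ^ m * y ^ n)) := by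
    intro m n x y hm hn
    rw [wittDpow_pos p R c hm, wittDpow_pos p R c hn]
    have e1 := versch_mul_versch p (x ^ m) (y ^ n)
    have e2 := h2 m n hm hn
    linear_combination c m * c n * e1 + verschiebung (x ^ m * y ^ n) * e2
  have hsmul : ∀ (n : ℕ) (a x : WittVector p R),
      wittDpow p R c n (a * verschiebung x) = a ^ n * wittDpow p R c n (verschiebung x) := by
    intro n a x
    rcases eq_or_ne n 0 with rfl | hn
    · rw [mul_versch, wittDpow_zero, wittDpow_zero]; simp
    · rw [mul_versch, wittDpow_pos p R c hn, wittDpow_pos p R c hn, mul_pow, ← map_pow,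
        ← mul_versch]
      ring
  refine ⟨{
    dpow := wittDpow p R c
    dpow_null := ?_
    dpow_zero := ?_
    dpow_one := ?_
    dpow_mem := ?_
    dpow_add := ?_
    dpow_mul := ?_
    mul_dpow := ?_
    dpow_comp := ?_ }, ?_⟩
  · intro n x hx
    exact dif_neg hx
  · rintro _ ⟨x, rfl⟩
    exact wittDpow_zero p R c x
  · rintro _ ⟨x, rfl⟩
    rw [wittDpow_pos p R c one_ne_zero, h1, one_mul, pow_one]
  · rintro n _ hn ⟨x, rfl⟩
    rw [wittDpow_pos p R c hn]
    exact Ideal.mul_mem_left _ _ ⟨_, rfl⟩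
  · rintro n _ _ ⟨x, rfl⟩ ⟨y, rfl⟩
    rcases eq_or_ne n 0 with rfl | hn
    · rw [← map_add, wittDpow_zero]
      simp [wittDpow_zero]
    · rw [← map_add, wittDpow_pos p R c hn, add_pow, ← Finset.Nat.sum_antidiagonal_eq_sum_range_succ
        (fun i j => x ^ i * y ^ j * (n.choose i : WittVector p R)), map_sum, Finset.mul_sum]
      refine Finset.sum_congr rfl ?_
      rintro ⟨i, j⟩ hij
      rw [Finset.HasAntidiagonal.mem_antidiagonal] at hij
      dsimp only at hij ⊢
      subst hij
      rcases eq_or_ne i 0 with rfl | hi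
      · have hj : j ≠ 0 := by simpa using hn
        simp [wittDpow_zero, wittDpow_pos p R c hj]
      rcases eq_or_ne j 0 with rfl | hj
      · simp [wittDpow_zero, wittDpow_pos p R c hi]
      rw [hmulpos i j x y hi hj]
      have e := mul_versch p ((i + j).choose i : WittVector p R) (x ^ i * y ^ j)
      rw [map_natCast, mul_comm ((i + j).choose i : WittVector p R) (x ^ i * y ^ j)] at e
      rw [← e]; ring
  · rintro n a _ ⟨x, rfl⟩
    exact hsmul n a x
  · rintro m n _ ⟨x, rfl⟩
    rcases eq_or_ne m 0 with rfl | hm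
    · simp [wittDpow_zero]
    rcases eq_or_ne n 0 with rfl | hn
    · simp [wittDpow_zero]
    rw [hmulpos m n x x hm hn, wittDpow_pos p R c (by omega : m + n ≠ 0), pow_add]
  · rintro m n _ hn ⟨x, rfl⟩
    rw [wittDpow_pos p R c hn, hsmul]
    rcases eq_or_ne m 0 with rfl | hm
    · simp [wittDpow_zero, Nat.uniformBell_zero_left]
    rw [wittDpow_pos p R c hm, wittDpow_pos p R c (mul_ne_zero hm hn), ← pow_mul, mul_comm n m]
    linear_combination verschiebung (x ^ (m * n)) * h3 m n hm hn
  · intro x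
    change _ * wittDpow p R c p _ = _
    rw [wittDpow_pos p R c hp.out.ne_zero, ← mul_assoc, h4]
end

section
/- Let 𝒜 and ℬ be additive categories (preadditive categories with finite biproducts), and regard their groupoid cores 𝒜^≃ and ℬ^≃ as symmetric monoidal categories with tensor product induced by the biproduct ⊕. Let F : 𝒜^≃ → ℬ^≃ be a symmetric monoidal functor, with structure isomorphisms μ_{X,Y} : F(X) ⊕ F(Y) ≅ F(X ⊕ Y). For an object Z, let e_Z denote the automorphism of Z ⊕ Z with matrix (1 1; 0 1), i.e. e_Z = 𝟙_{Z⊕Z} + (second projection) ∘ (first injection). Then F extends to an additive functor F̃ : 𝒜 → ℬ (meaning: F̃ agrees with F on objects and on isomorphisms, and for all X, Y the canonical morphism F̃(X) ⊕ F̃(Y) → F̃(X ⊕ Y) determined by F̃ applied to the biproduct injections equals μ_{X,Y}) if and only if for every object X of 𝒜 the equality μ_{X,X} ∘ e_{F(X)} = F(e_X) ∘ μ_{X,X} holds; moreover, in that case the extension F̃ is unique. -/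
/-!
STATEMENT 12: A symmetric monoidal functor F between the groupoid cores of two
additive categories (with tensor product induced by the biproduct) extends to an
additive functor F̃ iff μ_{X,X} ∘ e_{F(X)} = F(e_X) ∘ μ_{X,X} for every object X,
where e_Z is the automorphism (1 1; 0 1) of Z ⊞ Z; moreover the extension is unique.
-/

open CategoryTheory CategoryTheory.Limits ZeroObject

attribute [local instance] CategoryTheory.Limits.hasBinaryBiproducts_of_finite_biproducts

universe v u v' u'

variable (C : Type u) [Category.{v} C] [Preadditive C] [HasZeroObject C]
  [HasFiniteBiproducts C]
variable (D : Type u') [Category.{v'} D] [Preadditive D] [HasZeroObject D]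
  [HasFiniteBiproducts D]

/-- The shear automorphism of `Z ⊞ Z` with matrix `(1 1; 0 1)`,
`e_Z = 𝟙 + inl ∘ snd`. -/
noncomputable def shearIso {C : Type u} [Category.{v} C] [Preadditive C]
    [HasBinaryBiproducts C] (Z : C) : Z ⊞ Z ≅ Z ⊞ Z where
  hom := 𝟙 (Z ⊞ Z) + biprod.snd ≫ biprod.inl
  inv := 𝟙 (Z ⊞ Z) - biprod.snd ≫ biprod.inl
  hom_inv_id := by
    simp only [Preadditive.comp_sub, Preadditive.add_comp, Category.comp_id,
      Category.id_comp, Category.assoc, biprod.inl_snd_assoc, zero_comp, comp_zero]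
    abel
  inv_hom_id := by
    simp only [Preadditive.comp_add, Preadditive.sub_comp, Category.comp_id,
      Category.id_comp, Category.assoc, biprod.inl_snd_assoc, zero_comp, comp_zero]
    abel

/-- The canonical isomorphism `0 ⊞ X ≅ X`. -/
noncomputable def biprodLeftUnitor {C : Type u} [Category.{v} C] [HasZeroObject C]
    [HasZeroMorphisms C] [HasBinaryBiproducts C] (X : C) : (0 : C) ⊞ X ≅ X :=
  (isoZeroBiprod (isZero_zero C)).symm

/-- The canonical isomorphism `X ⊞ 0 ≅ X`. -/
noncomputable def biprodRightUnitor {C : Type u} [Category.{v} C] [HasZeroObject C]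
    [HasZeroMorphisms C] [HasBinaryBiproducts C] (X : C) : X ⊞ (0 : C) ≅ X :=
  (isoBiprodZero (isZero_zero C)).symm

/-- A symmetric monoidal functor between the groupoid cores of two additive
categories, with respect to the symmetric monoidal structures given by the
biproduct.  It consists of a functor between the cores (an assignment on objects
together with a functorial assignment on isomorphisms), a unit isomorphism and
natural structure isomorphisms `μ X Y : F X ⊞ F Y ≅ F (X ⊞ Y)`, satisfying the
associativity, unitality and symmetry coherence conditions. -/
structure CoreMonoidalFunctor : Type (max u u' v v') where
  obj : C → D
  map : ∀ {X Y : C}, (X ≅ Y) → (obj X ≅ obj Y)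
  map_id : ∀ X : C, map (Iso.refl X) = Iso.refl (obj X)
  map_comp : ∀ {X Y Z : C} (f : X ≅ Y) (g : Y ≅ Z), map (f ≪≫ g) = map f ≪≫ map g
  ε : (0 : D) ≅ obj 0
  μ : ∀ X Y : C, obj X ⊞ obj Y ≅ obj (X ⊞ Y)
  μ_natural : ∀ {X X' Y Y' : C} (f : X ≅ X') (g : Y ≅ Y'),
    biprod.map (map f).hom (map g).hom ≫ (μ X' Y').hom =
      (μ X Y).hom ≫ (map (biprod.mapIso f g)).hom
  associativity : ∀ X Y Z : C,
    biprod.map (μ X Y).hom (𝟙 (obj Z)) ≫ (μ (X ⊞ Y) Z).hom ≫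
        (map (biprod.associator X Y Z)).hom =
      (biprod.associator (obj X) (obj Y) (obj Z)).hom ≫
        biprod.map (𝟙 (obj X)) (μ Y Z).hom ≫ (μ X (Y ⊞ Z)).hom
  left_unitality : ∀ X : C,
    biprod.map ε.hom (𝟙 (obj X)) ≫ (μ 0 X).hom ≫ (map (biprodLeftUnitor X)).hom =
      (biprodLeftUnitor (obj X)).hom
  right_unitality : ∀ X : C,
    biprod.map (𝟙 (obj X)) ε.hom ≫ (μ X 0).hom ≫ (map (biprodRightUnitor X)).hom =
      (biprodRightUnitor (obj X)).hom
  braided : ∀ X Y : C,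
    (biprod.braiding (obj X) (obj Y)).hom ≫ (μ Y X).hom =
      (μ X Y).hom ≫ (map (biprod.braiding X Y)).hom

variable {C D}

/-- An additive functor `Ft : C ⥤ D` extends the symmetric monoidal functor `F`
between the groupoid cores: it agrees with `F` on objects and isomorphisms, and the
canonical comparison morphisms `Ft X ⊞ Ft Y ⟶ Ft (X ⊞ Y)` determined by the images
of the biproduct injections agree with the structure isomorphisms `μ`. -/
structure FunctorExtends (Ft : C ⥤ D) (F : CoreMonoidalFunctor C D) : Prop where
  objEq : ∀ X : C, Ft.obj X = F.obj X
  mapEq : ∀ {X Y : C} (f : X ≅ Y),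
    Ft.map f.hom = eqToHom (objEq X) ≫ (F.map f).hom ≫ eqToHom (objEq Y).symm
  μEq : ∀ X Y : C,
    biprod.desc (eqToHom (objEq X).symm ≫ Ft.map biprod.inl ≫ eqToHom (objEq (X ⊞ Y)))
        (eqToHom (objEq Y).symm ≫ Ft.map biprod.inr ≫ eqToHom (objEq (X ⊞ Y))) =
      (F.μ X Y).hom

/-- The generalized shear `(y, x) ↦ (y + f x, x)`. -/
noncomputable def gshear {C : Type u} [Category.{v} C] [Preadditive C]
    [HasBinaryBiproducts C] {X Y : C} (f : X ⟶ Y) : Y ⊞ X ≅ Y ⊞ X where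
  hom := 𝟙 (Y ⊞ X) + biprod.snd ≫ f ≫ biprod.inl
  inv := 𝟙 (Y ⊞ X) - biprod.snd ≫ f ≫ biprod.inl
  hom_inv_id := by
    simp only [Preadditive.comp_sub, Preadditive.add_comp, Category.comp_id,
      Category.id_comp, Category.assoc, biprod.inl_snd_assoc, zero_comp, comp_zero]
    abel
  inv_hom_id := by
    simp only [Preadditive.comp_add, Preadditive.sub_comp, Category.comp_id,
      Category.id_comp, Category.assoc, biprod.inl_snd_assoc, zero_comp, comp_zero]
    abel

section gen
variable {E : Type u} [Category.{v} E] [Preadditive E] [HasBinaryBiproducts E]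

/-- Block on positions 1 and 2. -/
noncomputable def blk12 {A B A1 B1 : E} (φ : A ⊞ B ≅ A1 ⊞ B1) (Z : E) :
    A ⊞ (B ⊞ Z) ≅ A1 ⊞ (B1 ⊞ Z) :=
  (biprod.associator A B Z).symm ≪≫ biprod.mapIso φ (Iso.refl Z) ≪≫ biprod.associator A1 B1 Z

/-- Swap the last two positions. -/
noncomputable def swp (A B Z : E) : A ⊞ (B ⊞ Z) ≅ A ⊞ (Z ⊞ B) :=
  biprod.mapIso (Iso.refl A) (biprod.braiding B Z)

/-- Block on positions 1 and 3. -/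
noncomputable def blk13 {A B A1 B1 : E} (φ : A ⊞ B ≅ A1 ⊞ B1) (Z : E) :
    A ⊞ (Z ⊞ B) ≅ A1 ⊞ (Z ⊞ B1) :=
  swp A Z B ≪≫ blk12 φ Z ≪≫ swp A1 B1 Z

/-- Block on positions 2 and 3. -/
noncomputable def blk23 {A B A1 B1 : E} (Z : E) (φ : A ⊞ B ≅ A1 ⊞ B1) :
    Z ⊞ (A ⊞ B) ≅ Z ⊞ (A1 ⊞ B1) :=
  biprod.mapIso (Iso.refl Z) φ

lemma gshear_triple {X Y Z : E} (f : X ⟶ Y) (g : Y ⟶ Z) :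
    blk23 Z (gshear f) ≪≫ blk12 (gshear g) X =
      blk12 (gshear g) X ≪≫ blk23 Z (gshear f) ≪≫ blk13 (gshear (f ≫ g)) Y := by
  ext <;> simp [blk23, blk12, blk13, swp, gshear]

lemma gshear_one (X : E) : gshear (𝟙 X) = shearIso X := by
  ext <;> simp [gshear, shearIso]

lemma gshear_add {X Y : E} (f g : X ⟶ Y) : gshear (f + g) = gshear f ≪≫ gshear g := by
  ext <;> simp [gshear]

lemma gshear_iso {X Y : E} (f : X ≅ Y) :
    biprod.mapIso f (Iso.refl X) ≪≫ gshear f.hom =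
      gshear (𝟙 X) ≪≫ biprod.mapIso f (Iso.refl X) := by
  ext <;> simp [gshear]

lemma gshear_inr (X Y : E) :
    gshear (biprod.inr : Y ⟶ X ⊞ Y) ≪≫ biprod.associator X Y Y =
      biprod.associator X Y Y ≪≫ blk23 X (gshear (𝟙 Y)) := by
  ext <;> simp [gshear, blk23]

lemma inl_blk12 {A B A1 B1 : E} (φ : A ⊞ B ≅ A1 ⊞ B1) (Z : E) :
    biprod.inl ≫ (blk12 φ Z).hom = biprod.inl ≫ φ.hom ≫ biprod.map (𝟙 _) biprod.inl := by
  have : (biprod.inl : A ⟶ A ⊞ (B ⊞ Z)) ≫ (biprod.associator A B Z).inv =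
    biprod.inl ≫ biprod.inl := by ext <;> simp
  simp only [blk12, Iso.trans_hom, Iso.symm_hom]
  rw [reassoc_of% this]
  ext <;> simp

lemma inr_inr_blk12 {A B A1 B1 : E} (φ : A ⊞ B ≅ A1 ⊞ B1) (Z : E) :
    biprod.inr ≫ biprod.inr ≫ (blk12 φ Z).hom = biprod.inr ≫ biprod.inr := by
  have : (biprod.inr : Z ⟶ (B ⊞ Z)) ≫ (biprod.inr : _ ⟶ A ⊞ (B ⊞ Z)) ≫
    (biprod.associator A B Z).inv = biprod.inr := by ext <;> simp
  simp only [blk12, Iso.trans_hom, Iso.symm_hom]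
  rw [reassoc_of% this]
  ext <;> simp

lemma inl_blk13 {A B A1 B1 : E} (φ : A ⊞ B ≅ A1 ⊞ B1) (Z : E) :
    biprod.inl ≫ (blk13 φ Z).hom = biprod.inl ≫ φ.hom ≫ biprod.map (𝟙 _) biprod.inr := by
  have : (biprod.inl : A ⟶ A ⊞ (Z ⊞ B)) ≫ (swp A Z B).hom = biprod.inl := by
    ext <;> simp [swp]
  simp only [blk13, Iso.trans_hom]
  rw [reassoc_of% this, reassoc_of% (inl_blk12 φ Z)]
  ext <;> simp [swp]

lemma inr_inr_blk13 {A B A1 B1 : E} (φ : A ⊞ B ≅ A1 ⊞ B1) (Z : E) :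
    biprod.inr ≫ biprod.inr ≫ (blk13 φ Z).hom =
      biprod.inr ≫ φ.hom ≫ biprod.map (𝟙 _) biprod.inr := by
  have h1 : (biprod.inr : B ⟶ (Z ⊞ B)) ≫ (biprod.inr : _ ⟶ A ⊞ (Z ⊞ B)) ≫ (swp A Z B).hom =
      biprod.inl ≫ biprod.inr := by
    ext <;> simp [swp]
  have h2 : (biprod.inl : B ⟶ (B ⊞ Z)) ≫ (biprod.inr : _ ⟶ A ⊞ (B ⊞ Z)) ≫
    (biprod.associator A B Z).inv = biprod.inr ≫ biprod.inl := by ext <;> simp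
  simp only [blk13, blk12, Iso.trans_hom, Iso.symm_hom, Category.assoc]
  rw [reassoc_of% h1, reassoc_of% h2]
  ext <;> simp [swp]

/-- In a triple, an unknown automorphism satisfying the shear commutation is a shear. -/
lemma shear_of_triple {X Y : E} (P : Y ⊞ X ≅ Y ⊞ X)
    (h : blk23 Y P ≪≫ blk12 (gshear (𝟙 Y)) X =
      blk12 (gshear (𝟙 Y)) X ≪≫ blk23 Y P ≪≫ blk13 P Y) :
    P = gshear (biprod.inr ≫ P.hom ≫ biprod.fst) := by
  have h := congrArg Iso.hom h
  simp only [Iso.trans_hom] at h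
  have g1 : (biprod.inl : Y ⟶ Y ⊞ Y) ≫ (gshear (𝟙 Y)).hom = biprod.inl := by simp [gshear]
  have k : (biprod.inl : Y ⟶ Y ⊞ (Y ⊞ X)) =
      biprod.inl ≫ P.hom ≫ biprod.map (𝟙 _) biprod.inr := by
    have := congrArg (fun t => biprod.inl ≫ t) h
    simp only [reassoc_of% (inl_blk12 (gshear (𝟙 Y)) X), reassoc_of% g1] at this
    simpa [blk23, inl_blk12, inl_blk13, reassoc_of% g1] using this
  have h1 : biprod.inl ≫ P.hom ≫ biprod.fst = 𝟙 Y := by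
    have := congrArg (fun t => t ≫ biprod.fst) k
    simpa using this.symm
  have h2 : biprod.inl ≫ P.hom ≫ biprod.snd = 0 := by
    have := congrArg (fun t => t ≫ biprod.snd ≫ biprod.snd) k
    simpa using this.symm
  have h3 : biprod.inl ≫ P.hom = biprod.inl := by
    ext <;> simp [h1, h2]
  have h4 : biprod.inl ≫ P.inv = biprod.inl := by
    rw [Iso.comp_inv_eq, h3]
  have h5 : biprod.inr ≫ P.hom ≫ biprod.snd = 𝟙 X := by
    have h7 : (biprod.inr ≫ P.hom ≫ biprod.snd) ≫ (biprod.inr ≫ P.hom ≫ biprod.snd) =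
        biprod.inr ≫ P.hom ≫ biprod.snd := by
      have e : P.hom ≫ (biprod.inr : _ ⟶ Y ⊞ (Y ⊞ X)) ≫ (blk13 P Y).hom ≫ biprod.snd ≫ biprod.snd =
          P.hom ≫ biprod.snd ≫ biprod.inr ≫ P.hom ≫ biprod.snd := by
        congr 1
        ext
        · have : (biprod.inl : Y ⟶ Y ⊞ X) ≫ (biprod.inr : _ ⟶ Y ⊞ (Y ⊞ X)) ≫ (swp Y Y X).hom =
              biprod.inr ≫ biprod.inr := by ext <;> simp [swp]
          simp only [blk13, Iso.trans_hom, Category.assoc]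
          rw [reassoc_of% this, reassoc_of% (inr_inr_blk12 P Y)]
          simp [swp]
        · simp only [reassoc_of% (inr_inr_blk13 P Y)]
          simp
      have h6 := congrArg (fun t => biprod.inr ≫ biprod.inr ≫ t ≫ biprod.snd ≫ biprod.snd) h
      simp only [Category.assoc, reassoc_of% (inr_inr_blk12 (gshear (𝟙 Y)) X)] at h6
      have h9 : (biprod.inr : _ ⟶ Y ⊞ (Y ⊞ X)) ≫ (blk23 Y P).hom = P.hom ≫ biprod.inr := by
        simp [blk23]
      simp only [reassoc_of% h9, e] at h6
      simpa [blk12] using h6.symm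
    have h8 : (biprod.inr ≫ P.inv ≫ biprod.snd) ≫ (biprod.inr ≫ P.hom ≫ biprod.snd) = 𝟙 X := by
      have e : P.hom ≫ biprod.snd = biprod.snd ≫ biprod.inr ≫ P.hom ≫ biprod.snd := by
        ext <;> simp [h2]
      have : (biprod.inr : X ⟶ Y ⊞ X) ≫ P.inv ≫ P.hom ≫ biprod.snd = 𝟙 X := by simp
      rw [e] at this
      simpa using this
    calc _ = ((biprod.inr ≫ P.inv ≫ biprod.snd) ≫ (biprod.inr ≫ P.hom ≫ biprod.snd)) ≫
          (biprod.inr ≫ P.hom ≫ biprod.snd) := by rw [h8, Category.id_comp]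
      _ = 𝟙 X := by rw [Category.assoc, h7, h8]
  ext <;> simp [gshear, h1, h2, h5]

end gen

namespace CoreMonoidalFunctor

variable (F : CoreMonoidalFunctor C D)

/-- `F` transported to binary block form. -/
noncomputable def T2 {A B A1 B1 : C} (φ : A ⊞ B ≅ A1 ⊞ B1) :
    F.obj A ⊞ F.obj B ≅ F.obj A1 ⊞ F.obj B1 :=
  F.μ A B ≪≫ F.map φ ≪≫ (F.μ A1 B1).symm

/-- The triple structure isomorphism. -/
noncomputable def μ3 (A B Z : C) : F.obj A ⊞ (F.obj B ⊞ F.obj Z) ≅ F.obj (A ⊞ (B ⊞ Z)) :=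
  biprod.mapIso (Iso.refl _) (F.μ B Z) ≪≫ F.μ A (B ⊞ Z)

/-- `F` transported to ternary block form. -/
noncomputable def T3 {A B Z A1 B1 Z1 : C} (φ : A ⊞ (B ⊞ Z) ≅ A1 ⊞ (B1 ⊞ Z1)) :
    F.obj A ⊞ (F.obj B ⊞ F.obj Z) ≅ F.obj A1 ⊞ (F.obj B1 ⊞ F.obj Z1) :=
  F.μ3 A B Z ≪≫ F.map φ ≪≫ (F.μ3 A1 B1 Z1).symm

lemma T2_comp {A B A1 B1 A2 B2 : C} (φ : A ⊞ B ≅ A1 ⊞ B1) (ψ : A1 ⊞ B1 ≅ A2 ⊞ B2) :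
    F.T2 (φ ≪≫ ψ) = F.T2 φ ≪≫ F.T2 ψ := by
  ext1; simp [T2, F.map_comp]

lemma T3_comp {A B Z A1 B1 Z1 A2 B2 Z2 : C} (φ : A ⊞ (B ⊞ Z) ≅ A1 ⊞ (B1 ⊞ Z1))
    (ψ : A1 ⊞ (B1 ⊞ Z1) ≅ A2 ⊞ (B2 ⊞ Z2)) :
    F.T3 (φ ≪≫ ψ) = F.T3 φ ≪≫ F.T3 ψ := by
  ext1; simp [T3, F.map_comp]

lemma nat_iso {X X1 Y Y1 : C} (f : X ≅ X1) (g : Y ≅ Y1) :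
    biprod.mapIso (F.map f) (F.map g) ≪≫ F.μ X1 Y1 = F.μ X Y ≪≫ F.map (biprod.mapIso f g) := by
  apply Iso.ext; simpa using F.μ_natural f g

lemma T2_mapIso {X X1 Y Y1 : C} (f : X ≅ X1) (g : Y ≅ Y1) :
    F.T2 (biprod.mapIso f g) = biprod.mapIso (F.map f) (F.map g) := by
  rw [T2, ← Iso.trans_assoc, ← nat_iso, Iso.trans_assoc, Iso.self_symm_id, Iso.trans_refl]

lemma T2_braiding (X Y : C) : F.T2 (biprod.braiding X Y) = biprod.braiding _ _ := by
  apply Iso.ext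
  simp only [T2, Iso.trans_hom, Iso.symm_hom]
  rw [← Category.assoc, ← F.braided, Category.assoc, Iso.hom_inv_id, Category.comp_id]

lemma mapIso_comp {E : Type u'} [Category.{v'} E] [Preadditive E] [HasBinaryBiproducts E]
    {A B A1 B1 A2 B2 : E} (f : A ≅ A1) (g : B ≅ B1) (f1 : A1 ≅ A2) (g1 : B1 ≅ B2) :
    biprod.mapIso f g ≪≫ biprod.mapIso f1 g1 = biprod.mapIso (f ≪≫ f1) (g ≪≫ g1) := by
  ext <;> simp

lemma T3_blk23 {A B A1 B1 : C} (Z : C) (φ : A ⊞ B ≅ A1 ⊞ B1) :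
    F.T3 (blk23 Z φ) = blk23 (F.obj Z) (F.T2 φ) := by
  apply Iso.ext
  have h := F.μ_natural (Iso.refl Z) φ
  simp only [T3, μ3, blk23, Iso.trans_hom, Iso.symm_hom, Category.assoc, Iso.trans_inv]
  rw [← reassoc_of% h, Iso.hom_inv_id_assoc, F.map_id]
  ext <;> simp [T2]

lemma T3_swp (A B Z : C) : F.T3 (swp A B Z) = swp (F.obj A) (F.obj B) (F.obj Z) := by
  have := F.T3_blk23 A (biprod.braiding B Z)
  rw [T2_braiding] at this
  exact this

lemma assoc_iso (X Y Z : C) :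
    biprod.mapIso (F.μ X Y) (Iso.refl _) ≪≫ F.μ (X ⊞ Y) Z ≪≫ F.map (biprod.associator X Y Z) =
      biprod.associator _ _ _ ≪≫ F.μ3 X Y Z := by
  apply Iso.ext
  simpa [μ3] using F.associativity X Y Z

lemma T3_blk12 {A B A1 B1 : C} (φ : A ⊞ B ≅ A1 ⊞ B1) (Z : C) :
    F.T3 (blk12 φ Z) = blk12 (F.T2 φ) (F.obj Z) := by
  have e1 : F.μ3 A B Z = (biprod.associator _ _ _).symm ≪≫
      biprod.mapIso (F.μ A B) (Iso.refl _) ≪≫ F.μ (A ⊞ B) Z ≪≫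
        F.map (biprod.associator A B Z) := by
    rw [assoc_iso, Iso.symm_self_id_assoc]
  have e2 : F.map (biprod.associator A1 B1 Z) ≪≫ (F.μ3 A1 B1 Z).symm =
      (F.μ (A1 ⊞ B1) Z).symm ≪≫ (biprod.mapIso (F.μ A1 B1) (Iso.refl _)).symm ≪≫
        biprod.associator _ _ _ := by
    have := F.assoc_iso A1 B1 Z
    have h := congrArg Iso.hom this
    apply Iso.ext
    simp only [Iso.trans_hom, Iso.symm_hom] at h ⊢
    rw [← cancel_epi (F.μ (A1 ⊞ B1) Z).hom,
      ← cancel_epi (biprod.mapIso (F.μ A1 B1) (Iso.refl (F.obj Z))).hom]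
    rw [reassoc_of% h]
    simp only [Iso.hom_inv_id_assoc, Iso.hom_inv_id, Category.comp_id]
  have e3 : F.map (biprod.associator A B Z) ≪≫ F.map (biprod.associator A B Z).symm =
      Iso.refl _ := by rw [← F.map_comp, Iso.self_symm_id, F.map_id]
  have e4 := F.nat_iso φ (Iso.refl Z)
  rw [F.map_id] at e4
  have h3 := congrArg Iso.hom e3
  have h4 := congrArg Iso.hom e4
  have h2 := congrArg Iso.hom e2
  rw [T3, e1, blk12, F.map_comp, F.map_comp]
  apply Iso.ext
  simp only [Iso.trans_hom, Iso.refl_hom, Category.assoc] at h2 h3 h4 ⊢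
  rw [h2, reassoc_of% h3, ← reassoc_of% h4]
  simp only [Iso.symm_hom, Iso.hom_inv_id_assoc]
  ext <;> simp [T2, blk12]

lemma T3_blk13 {A B A1 B1 : C} (φ : A ⊞ B ≅ A1 ⊞ B1) (Z : C) :
    F.T3 (blk13 φ Z) = blk13 (F.T2 φ) (F.obj Z) := by
  rw [blk13, T3_comp, T3_comp, T3_blk12, T3_swp, T3_swp]; rfl

/-- The candidate extension on morphisms. -/
noncomputable def G {X Y : C} (f : X ⟶ Y) : F.obj X ⟶ F.obj Y :=
  biprod.inr ≫ (F.T2 (gshear f)).hom ≫ biprod.fst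

lemma gshear_inj {E : Type u'} [Category.{v'} E] [Preadditive E] [HasBinaryBiproducts E]
    {X Y : E} (f : X ⟶ Y) : biprod.inr ≫ (gshear f).hom ≫ biprod.fst = f := by
  simp [gshear]

lemma T2_one (hF : ∀ X : C, (shearIso (F.obj X)).hom ≫ (F.μ X X).hom =
      (F.μ X X).hom ≫ (F.map (shearIso X)).hom)
    (X : C) : F.T2 (gshear (𝟙 X)) = gshear (𝟙 (F.obj X)) := by
  apply Iso.ext
  rw [gshear_one, gshear_one]
  simp only [T2, Iso.trans_hom, Iso.symm_hom]
  rw [← reassoc_of% (hF X), Iso.hom_inv_id, Category.comp_id]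

lemma T2_gshear (hF : ∀ X : C, (shearIso (F.obj X)).hom ≫ (F.μ X X).hom =
      (F.μ X X).hom ≫ (F.map (shearIso X)).hom)
    {X Y : C} (f : X ⟶ Y) : F.T2 (gshear f) = gshear (F.G f) := by
  apply shear_of_triple
  have := congrArg F.T3 (gshear_triple f (𝟙 Y))
  simpa only [T3_comp, T3_blk12, T3_blk23, T3_blk13, F.T2_one hF, Category.comp_id] using this

lemma G_one (hF : ∀ X : C, (shearIso (F.obj X)).hom ≫ (F.μ X X).hom =
      (F.μ X X).hom ≫ (F.map (shearIso X)).hom)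
    (X : C) : F.G (𝟙 X) = 𝟙 _ := by
  rw [G, F.T2_one hF, gshear_inj]

lemma G_add (hF : ∀ X : C, (shearIso (F.obj X)).hom ≫ (F.μ X X).hom =
      (F.μ X X).hom ≫ (F.map (shearIso X)).hom)
    {X Y : C} (f g : X ⟶ Y) : F.G (f + g) = F.G f + F.G g := by
  rw [G, gshear_add, T2_comp, F.T2_gshear hF, F.T2_gshear hF, ← gshear_add, gshear_inj]

lemma G_comp (hF : ∀ X : C, (shearIso (F.obj X)).hom ≫ (F.μ X X).hom =
      (F.μ X X).hom ≫ (F.map (shearIso X)).hom)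
    {X Y Z : C} (f : X ⟶ Y) (g : Y ⟶ Z) : F.G (f ≫ g) = F.G f ≫ F.G g := by
  have h1 := congrArg F.T3 (gshear_triple f g)
  simp only [T3_comp, T3_blk12, T3_blk23, T3_blk13, F.T2_gshear hF] at h1
  have h2 := gshear_triple (F.G f) (F.G g)
  rw [h2] at h1
  have h3 := congrArg (fun t => biprod.inr ≫ biprod.inr ≫ Iso.hom t ≫ biprod.fst) h1
  simpa [blk23, blk12, blk13, swp, gshear] using h3.symm

lemma G_iso (hF : ∀ X : C, (shearIso (F.obj X)).hom ≫ (F.μ X X).hom =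
      (F.μ X X).hom ≫ (F.map (shearIso X)).hom)
    {X Y : C} (f : X ≅ Y) : F.G f.hom = (F.map f).hom := by
  have h1 := congrArg F.T2 (gshear_iso f)
  simp only [T2_comp, T2_mapIso, F.T2_gshear hF, F.map_id, F.G_one hF] at h1
  have h3 := congrArg (fun t => biprod.inr ≫ Iso.hom t ≫ biprod.fst) h1
  simpa [gshear] using h3

lemma G_inr (hF : ∀ X : C, (shearIso (F.obj X)).hom ≫ (F.μ X X).hom =
      (F.μ X X).hom ≫ (F.map (shearIso X)).hom)
    (X Y : C) : F.G (biprod.inr : Y ⟶ X ⊞ Y) = biprod.inr ≫ (F.μ X Y).hom := by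
  have h1 := congrArg (fun t => Iso.hom (F.map t)) (gshear_inr X Y)
  have h2 := congrArg Iso.hom (F.T2_gshear hF (biprod.inr : Y ⟶ X ⊞ Y))
  have h3 := congrArg Iso.hom (F.T3_blk23 X (gshear (𝟙 Y)))
  rw [F.T2_one hF] at h3
  have h4 := congrArg Iso.hom (F.assoc_iso X Y Y)
  simp only [F.map_comp, T2, T3, Iso.trans_hom, Iso.symm_hom] at h1 h2 h3 h4
  rw [← Category.assoc, Iso.comp_inv_eq] at h2 h3
  -- compute `(μ ⊞ 1) ≫ μ ≫ F(shear) ≫ F(assoc)` in two ways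
  have h5 : (biprod.mapIso (F.μ X Y) (Iso.refl (F.obj Y))).hom ≫ (gshear (F.G biprod.inr)).hom =
      (biprod.associator _ _ _).hom ≫ (blk23 (F.obj X) (gshear (𝟙 (F.obj Y)))).hom ≫
        (biprod.associator _ _ _).inv ≫ (biprod.mapIso (F.μ X Y) (Iso.refl (F.obj Y))).hom := by
    rw [← cancel_mono (F.μ (X ⊞ Y) Y).hom, ← cancel_mono (F.map (biprod.associator X Y Y)).hom]
    simp only [Category.assoc]
    rw [h4, Iso.inv_hom_id_assoc, ← h3, ← reassoc_of% h4, ← h1, ← reassoc_of% h2]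
  have h6 := congrArg (fun t => biprod.inr ≫ t ≫ biprod.fst) h5
  have h7 : (biprod.inr : F.obj Y ⟶ (F.obj X ⊞ F.obj Y) ⊞ F.obj Y) ≫
      (biprod.associator _ _ _).hom = biprod.inr ≫ biprod.inr := by ext <;> simp
  have h8 : (biprod.inl : F.obj Y ⟶ F.obj Y ⊞ F.obj Y) ≫
      (biprod.inr : _ ⟶ F.obj X ⊞ (F.obj Y ⊞ F.obj Y)) ≫
      (biprod.associator _ _ _).inv = biprod.inr ≫ biprod.inl := by ext <;> simp
  have h9 : (biprod.inr : F.obj Y ⟶ F.obj Y ⊞ F.obj Y) ≫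
      (biprod.inr : _ ⟶ F.obj X ⊞ (F.obj Y ⊞ F.obj Y)) ≫
      (biprod.associator _ _ _).inv = biprod.inr := by ext <;> simp
  have h10 : (biprod.inr : F.obj Y ⟶ F.obj Y ⊞ F.obj Y) ≫
      (biprod.inr : _ ⟶ F.obj X ⊞ (F.obj Y ⊞ F.obj Y)) ≫
      (blk23 (F.obj X) (gshear (𝟙 (F.obj Y)))).hom =
      biprod.inr ≫ biprod.inr + biprod.inl ≫ biprod.inr := by simp [blk23, gshear]
  simp only [Category.assoc, reassoc_of% h7, reassoc_of% h10, Preadditive.add_comp,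
    reassoc_of% h8, reassoc_of% h9] at h6
  simpa [gshear] using h6

lemma G_inl (hF : ∀ X : C, (shearIso (F.obj X)).hom ≫ (F.μ X X).hom =
      (F.μ X X).hom ≫ (F.map (shearIso X)).hom)
    (X Y : C) : F.G (biprod.inl : X ⟶ X ⊞ Y) = biprod.inl ≫ (F.μ X Y).hom := by
  have e : (biprod.inl : X ⟶ X ⊞ Y) = biprod.inr ≫ (biprod.braiding Y X).hom := by
    ext <;> simp
  rw [e, F.G_comp hF, F.G_iso hF, F.G_inr hF, Category.assoc, ← F.braided]
  rw [← Category.assoc]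
  congr 1
  ext <;> simp

lemma ext_unique (K : ∀ {X Y : C}, (X ⟶ Y) → (F.obj X ⟶ F.obj Y))
    (hid : ∀ X, K (𝟙 X) = 𝟙 _) (hcomp : ∀ {X Y Z : C} (f : X ⟶ Y) (g : Y ⟶ Z), K (f ≫ g) = K f ≫ K g)
    (hadd : ∀ {X Y : C} (f g : X ⟶ Y), K (f + g) = K f + K g)
    (hiso : ∀ {X Y : C} (f : X ≅ Y), K f.hom = (F.map f).hom)
    (hμ : ∀ X Y, biprod.desc (K biprod.inl) (K biprod.inr) = (F.μ X Y).hom)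
    {X Y : C} (f : X ⟶ Y) : K f = F.G f := by
  have hz : ∀ X Y : C, K (0 : X ⟶ Y) = 0 := fun X Y => by
    have := hadd (0 : X ⟶ Y) 0
    simpa using this
  have hfst : K (biprod.fst : Y ⊞ X ⟶ Y) = (F.μ Y X).inv ≫ biprod.fst := by
    rw [Iso.eq_inv_comp, ← hμ]
    ext <;> simp [← hcomp, hid, hz]
  have hinr : K (biprod.inr : X ⟶ Y ⊞ X) = biprod.inr ≫ (F.μ Y X).hom := by
    rw [← hμ]; simp
  conv_lhs => rw [← gshear_inj f]
  rw [hcomp, hcomp, hiso, hfst, hinr]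
  simp [G, T2]

lemma ext_shear (K : ∀ {X Y : C}, (X ⟶ Y) → (F.obj X ⟶ F.obj Y))
    (hcomp : ∀ {X Y Z : C} (f : X ⟶ Y) (g : Y ⟶ Z), K (f ≫ g) = K f ≫ K g)
    (hadd : ∀ {X Y : C} (f g : X ⟶ Y), K (f + g) = K f + K g)
    (hiso : ∀ {X Y : C} (f : X ≅ Y), K f.hom = (F.map f).hom)
    (hμ : ∀ X Y, biprod.desc (K biprod.inl) (K biprod.inr) = (F.μ X Y).hom)
    (X : C) : (shearIso (F.obj X)).hom ≫ (F.μ X X).hom =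
          (F.μ X X).hom ≫ (F.map (shearIso X)).hom := by
  rw [← hμ, ← hiso]
  ext
  · simp [← hcomp, shearIso]
  · simp [← hcomp, ← hadd, shearIso]

end CoreMonoidalFunctor

/-- The transported morphism map of an extension. -/
def transK {Ft : C ⥤ D} {F : CoreMonoidalFunctor C D} (h : FunctorExtends Ft F)
    {X Y : C} (f : X ⟶ Y) : F.obj X ⟶ F.obj Y :=
  eqToHom (h.objEq X).symm ≫ Ft.map f ≫ eqToHom (h.objEq Y)

lemma transK_eq {Ft : C ⥤ D} (ha : Ft.Additive) {F : CoreMonoidalFunctor C D}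
    (h : FunctorExtends Ft F) {X Y : C} (f : X ⟶ Y) : transK h f = F.G f :=
  F.ext_unique (transK h) (fun X => by simp [transK]) (fun f g => by simp [transK])
    (fun f g => by simp [transK, Functor.map_add]) (fun f => by simp [transK, h.mapEq])
    (fun X Y => h.μEq X Y) f

theorem coreMonoidalFunctor_extends_iff_shear (F : CoreMonoidalFunctor C D) :
    ((∃ Ft : C ⥤ D, Ft.Additive ∧ FunctorExtends Ft F) ↔
      (∀ X : C,
        (shearIso (F.obj X)).hom ≫ (F.μ X X).hom =
          (F.μ X X).hom ≫ (F.map (shearIso X)).hom)) ∧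
    (∀ Ft Ft' : C ⥤ D, Ft.Additive → Ft'.Additive →
        FunctorExtends Ft F → FunctorExtends Ft' F → Ft = Ft') := by
  refine ⟨⟨?_, ?_⟩, ?_⟩
  · rintro ⟨Ft, ha, h⟩
    exact F.ext_shear (transK h) (fun f g => by simp [transK])
      (fun f g => by simp [transK, Functor.map_add]) (fun f => by simp [transK, h.mapEq])
      (fun X Y => h.μEq X Y)
  · intro hF
    refine ⟨{ obj := F.obj, map := F.G, map_id := F.G_one hF, map_comp := F.G_comp hF },
      ⟨fun {X Y f g} => F.G_add hF f g⟩, ⟨fun _ => rfl, fun f => ?_, fun X Y => ?_⟩⟩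
    · simpa using F.G_iso hF f
    · ext <;> simp [F.G_inl hF, F.G_inr hF]
  · intro Ft Ft' ha ha' h h'
    refine CategoryTheory.Functor.ext (fun X => (h.objEq X).trans (h'.objEq X).symm) ?_
    intro X Y f
    have e := (transK_eq ha h f).trans (transK_eq ha' h' f).symm
    have e2 : Ft.map f = eqToHom (h.objEq X) ≫ transK h f ≫ eqToHom (h.objEq Y).symm := by
      simp [transK]
    rw [e2, e]
    simp [transK]
end

section
/- Let 𝒜 and ℬ be additive categories, and let F, G : 𝒜^≃ → ℬ^≃ be symmetric monoidal functors between the groupoid cores (with tensor product induced by the biproduct ⊕). Suppose F̃, G̃ : 𝒜 → ℬ are additive functors extending F and G respectively (agreeing with them on objects and isomorphisms, and inducing their monoidal structure isomorphisms via the canonical biproduct comparison maps). Then every isomorphism of symmetric monoidal functors F ≅ G lifts uniquely to a natural isomorphism F̃ ≅ G̃ of additive functors. -/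
/-!
STATEMENT 13: Let 𝒜, ℬ be additive categories and F, G symmetric monoidal functors
between the groupoid cores (tensor product induced by the biproduct).  If F̃, G̃ are
additive functors extending F and G, then every isomorphism of symmetric monoidal
functors F ≅ G lifts uniquely to a natural isomorphism F̃ ≅ G̃.
-/

open CategoryTheory CategoryTheory.Limits ZeroObject

attribute [local instance] CategoryTheory.Limits.hasBinaryBiproducts_of_finite_biproducts

universe v u v' u'

variable (C : Type u) [Category.{v} C] [Preadditive C] [HasZeroObject C]
  [HasFiniteBiproducts C]
variable (D : Type u') [Category.{v'} D] [Preadditive D] [HasZeroObject D]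
  [HasFiniteBiproducts D]

variable {C D}

/-- An isomorphism of symmetric monoidal functors between groupoid cores: a natural
family of isomorphisms compatible with the unit and the structure isomorphisms. -/
structure CoreMonoidalIso (F G : CoreMonoidalFunctor C D) : Type (max u v') where
  app : ∀ X : C, F.obj X ≅ G.obj X
  naturality : ∀ {X Y : C} (f : X ≅ Y),
    (F.map f).hom ≫ (app Y).hom = (app X).hom ≫ (G.map f).hom
  unit : F.ε.hom ≫ (app 0).hom = G.ε.hom
  tensor : ∀ X Y : C,
    biprod.map (app X).hom (app Y).hom ≫ (G.μ X Y).hom =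
      (F.μ X Y).hom ≫ (app (X ⊞ Y)).hom

theorem coreMonoidalIso_lifts_uniquely (F G : CoreMonoidalFunctor C D)
    (Ft Gt : C ⥤ D) (hFt : Ft.Additive) (hGt : Gt.Additive)
    (hF : FunctorExtends Ft F) (hG : FunctorExtends Gt G)
    (t : CoreMonoidalIso F G) :
    ∃! η : Ft ≅ Gt, ∀ X : C,
      η.hom.app X = eqToHom (hF.objEq X) ≫ (t.app X).hom ≫ eqToHom (hG.objEq X).symm := by
  let s : ∀ X : C, Ft.obj X ≅ Gt.obj X := fun X =>
    eqToIso (hF.objEq X) ≪≫ t.app X ≪≫ eqToIso (hG.objEq X).symm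
  have hs : ∀ X, (s X).hom =
      eqToHom (hF.objEq X) ≫ (t.app X).hom ≫ eqToHom (hG.objEq X).symm := fun X => by
    simp [s]
  have hiso : ∀ {X Y : C} (f : X ≅ Y),
      Ft.map f.hom ≫ (s Y).hom = (s X).hom ≫ Gt.map f.hom := by
    intro X Y f
    rw [hF.mapEq, hG.mapEq, hs, hs]
    simp only [Category.assoc, eqToHom_trans_assoc, eqToHom_refl, Category.id_comp]
    rw [← Category.assoc (F.map f).hom, t.naturality, Category.assoc]
  have hinl : ∀ X Y : C, Ft.map (biprod.inl : X ⟶ X ⊞ Y) ≫ (s (X ⊞ Y)).hom =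
      (s X).hom ≫ Gt.map biprod.inl := by
    intro X Y
    have h := t.tensor X Y
    rw [← hF.μEq, ← hG.μEq] at h
    have h1 := congrArg (fun k => eqToHom (hF.objEq X) ≫ biprod.inl ≫ k ≫
      eqToHom (hG.objEq (X ⊞ Y)).symm) h
    simp at h1
    rw [hs, hs]
    simp [h1]
  have hinr : ∀ X Y : C, Ft.map (biprod.inr : Y ⟶ X ⊞ Y) ≫ (s (X ⊞ Y)).hom =
      (s Y).hom ≫ Gt.map biprod.inr := by
    intro X Y
    have h := t.tensor X Y
    rw [← hF.μEq, ← hG.μEq] at h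
    have h1 := congrArg (fun k => eqToHom (hF.objEq Y) ≫ biprod.inr ≫ k ≫
      eqToHom (hG.objEq (X ⊞ Y)).symm) h
    simp at h1
    rw [hs, hs]
    simp [h1]
  have hnat : ∀ {X Y : C} (f : X ⟶ Y), Ft.map f ≫ (s Y).hom = (s X).hom ≫ Gt.map f := by
    intro X Y f
    have hu : biprod.inl ≫ (Biprod.unipotentUpper f).hom =
        (biprod.inl : X ⟶ X ⊞ Y) + f ≫ biprod.inr := by
      ext <;> simp
    have h1 : Ft.map (biprod.inl ≫ (Biprod.unipotentUpper f).hom) ≫ (s (X ⊞ Y)).hom =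
        (s X).hom ≫ Gt.map (biprod.inl ≫ (Biprod.unipotentUpper f).hom) := by
      rw [Ft.map_comp, Gt.map_comp, Category.assoc, hiso, ← Category.assoc, hinl,
        Category.assoc]
    rw [hu, Ft.map_add, Gt.map_add, Preadditive.add_comp, Preadditive.comp_add, hinl,
      add_right_inj, Ft.map_comp, Gt.map_comp, Category.assoc, hinr] at h1
    have h2 := congrArg (fun k => k ≫ Gt.map biprod.snd) h1
    simp only [Category.assoc] at h2
    rw [← Gt.map_comp, biprod.inr_snd, Gt.map_id] at h2
    simpa only [Category.comp_id] using h2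
  refine ⟨NatIso.ofComponents s hnat, fun X => ?_, fun η hη => ?_⟩
  · simpa using hs X
  · ext X
    rw [hη X]
    simpa using (hs X).symm
end

section
/- Let p be a prime and R a commutative ring of characteristic p. Let R^♭ denote the inverse-limit perfection of R, i.e., the ring of sequences (a_n)_{n≥0} in R with a_{n+1}^p = a_n for all n, with projections pr_n : R^♭ → R. Then the induced ring homomorphisms W(pr_n) : W(R^♭) → W(R) satisfy F ∘ W(pr_{n+1}) = W(pr_n), where F is the Witt vector Frobenius, and the resulting ring homomorphism from W(R^♭) to the inverse limit of the system (⋯ → W(R) →^F W(R) →^F W(R)) is an isomorphism. -/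
/-!
STATEMENT 14: Let p be a prime and R a commutative ring of characteristic p.  Let
R^♭ denote the inverse-limit perfection of R.  Then the induced ring homomorphisms
W(pr_n) : W(R^♭) → W(R) satisfy F ∘ W(pr_{n+1}) = W(pr_n), and the resulting ring
homomorphism from W(R^♭) to the inverse limit of (⋯ → W(R) →^F W(R) →^F W(R)) is an
isomorphism.
-/

theorem witt_perfection_iso_limit_frobenius (p : ℕ) [hp : Fact p.Prime]
    (R : Type*) [CommRing R] [CharP R p] :
    (∀ (x : WittVector p (Ring.Perfection R p)) (n : ℕ),
        WittVector.frobenius (WittVector.map (Perfection.coeff R p (n + 1)) x) =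
          WittVector.map (Perfection.coeff R p n) x) ∧
    Function.Injective
      (fun x : WittVector p (Ring.Perfection R p) =>
        (fun n : ℕ => WittVector.map (Perfection.coeff R p n) x : ℕ → WittVector p R)) ∧
    Set.range
      (fun x : WittVector p (Ring.Perfection R p) =>
        (fun n : ℕ => WittVector.map (Perfection.coeff R p n) x : ℕ → WittVector p R)) =
      {v : ℕ → WittVector p R | ∀ n : ℕ, WittVector.frobenius (v (n + 1)) = v n} := by
  have h1 : ∀ (x : WittVector p (Ring.Perfection R p)) (n : ℕ),
        WittVector.frobenius (WittVector.map (Perfection.coeff R p (n + 1)) x) =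
          WittVector.map (Perfection.coeff R p n) x := by
    intro x n
    ext k
    rw [WittVector.coeff_frobenius_charP]
    exact (x.coeff k).2 n
  refine ⟨h1, ?_, ?_⟩
  · intro x y h
    ext k
    refine Subtype.ext (funext fun n => ?_)
    have h2 := congrArg (fun w : WittVector p R => w.coeff k) (congrFun h n)
    exact h2
  · ext v
    constructor
    · rintro ⟨x, rfl⟩ n
      exact h1 x n
    · intro hv
      refine ⟨WittVector.mk p fun k => ⟨fun n => (v n).coeff k, fun n => ?_⟩, ?_⟩
      · rw [← WittVector.coeff_frobenius_charP, hv n]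
      · funext n
        ext k
        rfl
end
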